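/- arXiv:1502.02933 — 2 statements merged into one kernel-verified Lean document; each statement's English description precedes it below -/
import Mathlib

section
/- Every 2-connected {P5, K4⁻}-free graph contains a longest cycle which is a dominating cycle. -/
open SimpleGraph

variable {V : Type*} [Fintype V] [DecidableEq V]

/-- `p 0, p 1, ..., p (n-1)` is a path of order `n` in `G`. -/
def IsPathOn (G : SimpleGraph V) (n : ℕ) (p : ℕ → V) : Prop :=
  (∀ i j, i < n → j < n → p i = p j → i = j) ∧
  (∀ i, i + 1 < n → G.Adj (p i) (p (i + 1)))

/-- An induced path of order `n` in `G`. -/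
def IsInducedPathOn (G : SimpleGraph V) (n : ℕ) (p : ℕ → V) : Prop :=
  IsPathOn G n p ∧ ∀ i j, i < n → j < n → G.Adj (p i) (p j) → (i + 1 = j ∨ j + 1 = i)

/-- `G` contains no induced path on 5 vertices. -/
def P5Free (G : SimpleGraph V) : Prop := ¬ ∃ p : ℕ → V, IsInducedPathOn G 5 p

/-- `G` contains no induced `K₄` minus an edge. -/
def K4mFree (G : SimpleGraph V) : Prop :=
  ¬ ∃ a b c d : V, a ≠ b ∧ a ≠ c ∧ a ≠ d ∧ b ≠ c ∧ b ≠ d ∧ c ≠ d ∧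
    G.Adj a b ∧ G.Adj a c ∧ G.Adj a d ∧ G.Adj b c ∧ G.Adj b d ∧ ¬ G.Adj c d

/-- `G` contains no induced `W*` (two triangles `abc`, `def` joined by the edge `cd`). -/
def WStarFree (G : SimpleGraph V) : Prop :=
  ¬ ∃ a b c d e f : V, List.Nodup [a, b, c, d, e, f] ∧
    G.Adj a b ∧ G.Adj b c ∧ G.Adj a c ∧ G.Adj d e ∧ G.Adj e f ∧ G.Adj d f ∧ G.Adj c d ∧
    ¬ G.Adj a d ∧ ¬ G.Adj a e ∧ ¬ G.Adj a f ∧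
    ¬ G.Adj b d ∧ ¬ G.Adj b e ∧ ¬ G.Adj b f ∧ ¬ G.Adj c e ∧ ¬ G.Adj c f

/-- `G` contains no induced paw (triangle `abc` with pendant edge `cd`). -/
def Z1Free (G : SimpleGraph V) : Prop :=
  ¬ ∃ a b c d : V, List.Nodup [a, b, c, d] ∧
    G.Adj a b ∧ G.Adj b c ∧ G.Adj a c ∧ G.Adj c d ∧ ¬ G.Adj a d ∧ ¬ G.Adj b d

/-- An (oriented) cycle of length `n` in `G`, as an injective map `ZMod n → V`
with consecutive vertices adjacent. -/
def IsCycleOn (G : SimpleGraph V) (n : ℕ) (c : ZMod n → V) : Prop :=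
  3 ≤ n ∧ Function.Injective c ∧ ∀ i, G.Adj (c i) (c (i + 1))

/-- A longest cycle of `G`. -/
def IsLongestCycle (G : SimpleGraph V) (n : ℕ) (c : ZMod n → V) : Prop :=
  IsCycleOn G n c ∧ ∀ (m : ℕ) (d : ZMod m → V), IsCycleOn G m d → m ≤ n

/-- A dominating cycle: every edge of `G` is incident with a vertex of the cycle. -/
def DominatingCycle (G : SimpleGraph V) (n : ℕ) (c : ZMod n → V) : Prop :=
  IsCycleOn G n c ∧ ∀ u v : V, G.Adj u v → u ∈ Set.range c ∨ v ∈ Set.range c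

/-- `H` is (the vertex set of) a connected component of `G - R`. -/
def IsCompOff (G : SimpleGraph V) (R : Set V) (H : Set V) : Prop :=
  H.Nonempty ∧ Disjoint H R ∧ (G.induce H).Connected ∧
  ∀ u v : V, u ∈ H → v ∉ H → v ∉ R → ¬ G.Adj u v

/-- `μ`: the maximum order of a component of `G - R`. -/
noncomputable def muC (G : SimpleGraph V) (R : Set V) : ℕ :=
  sSup {k | ∃ H : Set V, IsCompOff G R H ∧ H.ncard = k}

/-- `ω`: the number of components of `G - R` of maximum order. -/
noncomputable def omegaC (G : SimpleGraph V) (R : Set V) : ℕ :=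
  {H : Set V | IsCompOff G R H ∧ H.ncard = muC G R}.ncard

/-- `G` is 2-connected: at least 3 vertices, connected, and removing any
vertex leaves it connected. -/
def TwoConnected (G : SimpleGraph V) : Prop :=
  3 ≤ Fintype.card V ∧ G.Connected ∧
  ∀ v : V, (G.induce ({v}ᶜ : Set V)).Connected

/-- The set of indices of `ZMod n` encountered going from `s` to `t` in the
positive direction (including both `s` and `t`). -/
def seg (n : ℕ) (s t : ZMod n) : Set (ZMod n) :=
  {x | ∃ k : ℕ, x = s + (k : ZMod n) ∧ ∀ m : ℕ, m < k → s + (m : ZMod n) ≠ t}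

/-- `G` is complete multipartite: the vertices partition into classes of an
equivalence relation which are independent, with all edges between classes. -/
def CompleteMultipartite (G : SimpleGraph V) : Prop :=
  ∃ r : V → V → Prop, Equivalence r ∧ ∀ u v : V, u ≠ v → (G.Adj u v ↔ ¬ r u v)

/-- A `C`-path (for `R = V(C)`): a path of order at least 2 whose ends lie in
`R` and whose internal vertices avoid `R`. -/
def IsCPath (G : SimpleGraph V) (R : Set V) (m : ℕ) (p : ℕ → V) : Prop :=
  2 ≤ m ∧ IsPathOn G m p ∧ p 0 ∈ R ∧ p (m - 1) ∈ R ∧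
  ∀ i, 0 < i → i < m - 1 → p i ∉ R

set_option linter.unusedSectionVars false

/-- `HP G a b S`: there is a path from `a` to `b` whose vertex set is exactly `S`. -/
inductive HP (G : SimpleGraph V) : V → V → Finset V → Prop
  | single (a : V) : HP G a a {a}
  | cons {a b c : V} {S : Finset V} : G.Adj a b → HP G b c S → a ∉ S → HP G a c (insert a S)

namespace HP
variable {G : SimpleGraph V} {a b c d : V} {S T : Finset V}

theorem left_mem (h : HP G a b S) : a ∈ S := by
  cases h <;> simp

theorem right_mem (h : HP G a b S) : b ∈ S := by
  induction h with
  | single a => simp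
  | cons _ _ _ ih => simp [ih]

theorem append (h : HP G a b S) (h' : HP G c d T) (hbc : G.Adj b c) (hd : ∀ t ∈ S, t ∉ T) :
    HP G a d (S ∪ T) := by
  induction h with
  | single a => 
    have := HP.cons hbc h' (hd a (by simp))
    rwa [← Finset.insert_eq]
  | @cons a b c S hab h1 hn ih =>
    rw [Finset.insert_union]
    refine HP.cons hab (ih hbc (fun t ht => hd t (by simp [ht]))) ?_
    simp only [Finset.mem_union, not_or]
    exact ⟨hn, hd a (by simp)⟩

theorem symm (h : HP G a b S) : HP G b a S := by
  induction h with
  | single a => exact HP.single a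
  | @cons a b c S hab h1 hn ih =>
    have := ih.append (HP.single a) hab.symm (by intro t ht; simp; rintro rfl; exact hn ht)
    rwa [Finset.union_comm, ← Finset.insert_eq] at this

theorem congr' (h : HP G a b S) (e : ∀ t, t ∈ S ↔ t ∈ T) : HP G a b T := by
  have : S = T := Finset.ext e
  exact this ▸ h

/-- Either trivial, or peel off the first vertex. -/
theorem inv (h : HP G a b S) : (a = b ∧ ∀ t, t ∈ S ↔ t = a) ∨
    ∃ c T, G.Adj a c ∧ HP G c b T ∧ a ∉ T ∧ ∀ t, t ∈ S ↔ t = a ∨ t ∈ T := by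
  cases h with
  | single a => left; simp
  | @cons a b c S hab h1 hn => right; exact ⟨_, _, hab, h1, hn, by simp⟩

theorem self_eq (h : HP G a a S) : ∀ t, t ∈ S ↔ t = a := by
  rcases h.inv with ⟨_, h⟩ | ⟨c, T, _, h1, h2, _⟩
  · exact h
  · exact absurd h1.right_mem h2

/-- Split a path at a vertex. -/
theorem split (h : HP G a b S) : ∀ y ∈ S, y ≠ b → ∃ w S1 S2, HP G a y S1 ∧ G.Adj y w ∧ HP G w b S2 ∧
    (∀ t ∈ S1, t ∉ S2) ∧ ∀ t, t ∈ S ↔ t ∈ S1 ∨ t ∈ S2 := by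
  induction h with
  | single a => intro y hy; simp at hy; simp [hy]
  | @cons a b c S hab h1 hn ih =>
    intro y hy hne
    by_cases hya : y = a
    · subst hya
      exact ⟨b, {y}, S, HP.single y, hab, h1, by simpa using hn, by simp⟩
    · have hyS : y ∈ S := by simpa [hya] using hy
      obtain ⟨w, S1, S2, p1, p2, p3, p4, p5⟩ := ih y hyS hne
      refine ⟨w, insert a S1, S2, HP.cons hab p1 ?_, p2, p3, ?_, ?_⟩
      · intro h; exact hn ((p5 a).2 (Or.inl h))
      · intro t ht
        rcases Finset.mem_insert.1 ht with rfl | ht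
        · intro h; exact hn ((p5 _).2 (Or.inr h))
        · exact p4 t ht
      · intro t; simp [p5, or_assoc]

/-- Split a path at the first vertex that fails `P`. -/
theorem splitP (P : V → Prop) (h : HP G a b S) : P a → (∀ t ∈ S, P t) ∨
    ∃ r w K T, HP G a r K ∧ G.Adj r w ∧ HP G w b T ∧ (∀ t ∈ K, P t) ∧ ¬ P w ∧
    (∀ t ∈ K, t ∉ T) ∧ ∀ t, t ∈ S ↔ t ∈ K ∨ t ∈ T := by
  induction h with
  | single a => intro h; left; simpa using h
  | @cons a b c S hab h1 hn ih =>
    intro ha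
    by_cases hb : P b
    · rcases ih hb with h | ⟨r, w, K, T, p1, p2, p3, p4, p5, p6, p7⟩
      · left; simpa using ⟨ha, h⟩
      · right
        refine ⟨r, w, insert a K, T, HP.cons hab p1 ?_, p2, p3, by simpa using ⟨ha, p4⟩, p5, ?_, ?_⟩
        · intro h; exact hn ((p7 a).2 (Or.inl h))
        · intro t ht
          rcases Finset.mem_insert.1 ht with rfl | ht
          · intro h; exact hn ((p7 _).2 (Or.inr h))
          · exact p6 t ht
        · intro t; simp [p7, or_assoc]
    · right
      exact ⟨a, b, {a}, S, HP.single a, hab, h1, by simpa using ha, hb, by simpa using hn, by simp⟩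

/-- A clique has a Hamiltonian path between any two of its vertices. -/
theorem clique : ∀ (k : ℕ) (S : Finset V) (a b : V), S.card = k →
    (∀ s ∈ S, ∀ t ∈ S, s ≠ t → G.Adj s t) → a ∈ S → b ∈ S → a ≠ b → HP G a b S := by
  intro k
  induction k with
  | zero => intro S a b h _ ha; rw [Finset.card_eq_zero] at h; subst h; simp at ha
  | succ k ih =>
    intro S a b hk hS ha hb hab
    have e : insert a (S.erase a) = S := Finset.insert_erase ha
    by_cases h : ∃ c ∈ S, c ≠ a ∧ c ≠ b
    · obtain ⟨c, hc, hca, hcb⟩ := h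
      have := ih (S.erase a) c b (by rw [Finset.card_erase_of_mem ha, hk]; rfl)
        (fun s hs t ht => hS s (Finset.mem_of_mem_erase hs) t (Finset.mem_of_mem_erase ht))
        (by simp [hc, hca]) (by simp [hb, hab.symm]) hcb
      have := HP.cons (hS a ha c hc hca.symm) this (by simp)
      rwa [e] at this
    · push Not at h
      have e2 : S.erase a = {b} := by
        ext t; simp only [Finset.mem_erase, Finset.mem_singleton]
        constructor
        · rintro ⟨h1, h2⟩; exact h t h2 h1
        · rintro rfl; exact ⟨hab.symm, hb⟩
      have := HP.cons (hS a ha b hb hab) (HP.single b) (by simpa using hab)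
      rw [← e2, e] at this
      exact this

end HP

/-- Everything we need to know about a longest cycle `C` and a component `H` of `G - C`. -/
structure Ctx (G : SimpleGraph V) (C : Finset V) (H : Set V) : Prop where
  p5 : ∀ a b c d e, G.Adj a b → G.Adj b c → G.Adj c d → G.Adj d e →
    G.Adj a c ∨ G.Adj a d ∨ G.Adj a e ∨ G.Adj b d ∨ G.Adj b e ∨ G.Adj c e
  k4 : ∀ a b c d, G.Adj a b → G.Adj a c → G.Adj a d → G.Adj b c → G.Adj b d → c ≠ d → G.Adj c d
  mx : ∀ a b S, HP G a b S → G.Adj b a → C.card < S.card → False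
  rot : ∀ x ∈ C, ∃ p z S, HP G p z S ∧ x ∉ S ∧ (∀ t, t ∈ C ↔ t = x ∨ t ∈ S) ∧ G.Adj x p ∧
    G.Adj z x ∧ p ≠ z
  hout : ∀ h ∈ H, h ∉ C
  hcl : ∀ h ∈ H, ∀ w, G.Adj h w → w ∉ C → w ∈ H
  hpath : ∀ g ∈ H, ∀ h ∈ H, ∃ W, HP G g h W ∧ ∀ t ∈ W, t ∉ C
  hind : ∀ P : V → Prop, ∀ g ∈ H, P g → (∀ a ∈ H, ∀ b ∈ H, G.Adj a b → P a → P b) → ∀ h ∈ H, P h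
  two : ∀ (d : V) (X : Set V), (∃ a ∈ X, a ≠ d) → (∃ b, b ∉ X ∧ b ≠ d) →
    ∃ a b, a ∈ X ∧ a ≠ d ∧ b ∉ X ∧ b ≠ d ∧ G.Adj a b

namespace Ctx
variable {G : SimpleGraph V} {C : Finset V} {H : Set V}

theorem cyc1 (X : Ctx G C H) {a b u : V} {S : Finset V} (h : HP G a b S) (hab : G.Adj b a)
    (hC : ∀ t ∈ C, t ∈ S) (hu : u ∈ S) (hn : u ∉ C) : False := by
  refine X.mx a b S h hab (Finset.card_lt_card ⟨hC, fun hh => hn (hh hu)⟩)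

theorem cyc2 (X : Ctx G C H) {a b u v d : V} {S : Finset V} (h : HP G a b S) (hab : G.Adj b a)
    (hC : ∀ t ∈ C, t ≠ d → t ∈ S) (hu : u ∈ S) (hn : u ∉ C) (hv : v ∈ S) (hnv : v ∉ C)
    (huv : u ≠ v) : False := by
  refine X.mx a b S h hab ?_
  have h1 : insert u (insert v (C.erase d)) ⊆ S := by
    intro t ht
    simp only [Finset.mem_insert, Finset.mem_erase] at ht
    rcases ht with rfl | rfl | ⟨h1, h2⟩
    · exact hu
    · exact hv
    · exact hC t h2 h1
  have h2 := Finset.card_le_card h1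
  rw [Finset.card_insert_of_notMem (by simp [huv, hn]), Finset.card_insert_of_notMem (by simp [hnv])] at h2
  have := Finset.pred_card_le_card_erase (s := C) (a := d)
  omega

/-- A path inside the neighbourhood of `x` is a clique. -/
theorem nbr_clique (X : Ctx G C H) {x a b : V} {S : Finset V} (h : HP G a b S) :
    (∀ t ∈ S, G.Adj x t) → ∀ s ∈ S, ∀ t ∈ S, s ≠ t → G.Adj s t := by
  induction h with
  | single a => intro _ s hs t ht hne; simp at hs ht; subst hs; subst ht; exact absurd rfl hne
  | @cons a b c S hab h1 hn ih =>
    intro hx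
    have hS := ih (fun t ht => hx t (by simp [ht]))
    have key : ∀ t ∈ S, G.Adj a t := by
      intro t ht
      by_cases htb : t = b
      · subst htb; exact hab
      · exact X.k4 x b a t (hx b (by simp [h1.left_mem])) (hx a (by simp)) (hx t (by simp [ht])) hab.symm
          (hS b h1.left_mem t ht (Ne.symm htb)) (by rintro rfl; exact hn ht)
    intro s hs t ht hne
    rcases Finset.mem_insert.1 hs with hs' | hs' <;> rcases Finset.mem_insert.1 ht with ht' | ht'
    · exact absurd (hs'.trans ht'.symm) hne
    · subst hs'; exact key t ht'
    · subst ht'; exact (key s hs').symm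
    · exact hS s hs' t ht' hne

end Ctx

namespace Ctx
variable {G : SimpleGraph V} {C : Finset V} {H : Set V}

/-- `X.p5` in negated form. -/
theorem p5x (X : Ctx G C H) (a b c d e : V)
    (e0 : G.Adj a b := by first | assumption | exact SimpleGraph.Adj.symm (by assumption))
    (e1 : G.Adj b c := by first | assumption | exact SimpleGraph.Adj.symm (by assumption))
    (e2 : G.Adj c d := by first | assumption | exact SimpleGraph.Adj.symm (by assumption))
    (e3 : G.Adj d e := by first | assumption | exact SimpleGraph.Adj.symm (by assumption))
    (n0 : ¬ G.Adj a c := by first | assumption | exact mt SimpleGraph.Adj.symm (by assumption))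
    (n1 : ¬ G.Adj a d := by first | assumption | exact mt SimpleGraph.Adj.symm (by assumption))
    (n2 : ¬ G.Adj a e := by first | assumption | exact mt SimpleGraph.Adj.symm (by assumption))
    (n3 : ¬ G.Adj b d := by first | assumption | exact mt SimpleGraph.Adj.symm (by assumption))
    (n4 : ¬ G.Adj b e := by first | assumption | exact mt SimpleGraph.Adj.symm (by assumption))
    (n5 : ¬ G.Adj c e := by first | assumption | exact mt SimpleGraph.Adj.symm (by assumption))
    : False := by
  have := X.p5 a b c d e e0 e1 e2 e3
  tauto

theorem k4x (X : Ctx G C H) (a b c d : V)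
    (e0 : G.Adj a b := by first | assumption | exact SimpleGraph.Adj.symm (by assumption))
    (e1 : G.Adj a c := by first | assumption | exact SimpleGraph.Adj.symm (by assumption))
    (e2 : G.Adj a d := by first | assumption | exact SimpleGraph.Adj.symm (by assumption))
    (e3 : G.Adj b c := by first | assumption | exact SimpleGraph.Adj.symm (by assumption))
    (e4 : G.Adj b d := by first | assumption | exact SimpleGraph.Adj.symm (by assumption))
    (hne : c ≠ d := by first | assumption | exact Ne.symm (by assumption))
    : G.Adj c d := X.k4 a b c d e0 e1 e2 e3 e4 hne

end Ctx

/-- `C` is `x`, followed by a clique `K` (a path `p … r`) in the neighbourhood of `x`, followed by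
a path `T = y … z` back to `x`, with `y` not adjacent to `x`. -/
structure Seg (G : SimpleGraph V) (C : Finset V) (x p r y z : V) (K T : Finset V) : Prop where
  hK : HP G p r K
  hT : HP G y z T
  xK : ∀ t ∈ K, G.Adj x t
  ry : G.Adj r y
  zx : G.Adj z x
  xy : ¬ G.Adj x y
  hC : ∀ t, t ∈ C ↔ t = x ∨ t ∈ K ∨ t ∈ T
  nK : x ∉ K
  nT : x ∉ T
  nKT : ∀ t ∈ K, t ∉ T

namespace Seg
variable {G : SimpleGraph V} {C : Finset V} {H : Set V} {x p r y z : V} {K T : Finset V}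

theorem cl (s : Seg G C x p r y z K T) (X : Ctx G C H) : ∀ s ∈ K, ∀ t ∈ K, s ≠ t → G.Adj s t :=
  X.nbr_clique s.hK s.xK

theorem path (s : Seg G C x p r y z K T) (X : Ctx G C H) {a b : V} (ha : a ∈ K) (hb : b ∈ K)
    (hab : a ≠ b) : HP G a b K := HP.clique _ K a b rfl (s.cl X) ha hb hab

theorem unatt (s : Seg G C x p r y z K T) (X : Ctx G C H) {u h k : V} (hu : u ∈ H) (hh : h ∈ H)
    (hxu : G.Adj x u) (hk : k ∈ K) (hkr : k ≠ r ∨ k = p) : ¬ G.Adj k h := by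
  intro hkh
  obtain ⟨hK, hT, xK, ry, zx, xy, hC, nK, nT, nKT⟩ := id s
  have hp : HP G k r K := by
    rcases hkr with h | rfl
    · exact s.path X hk hK.right_mem h
    · exact hK
  obtain ⟨W, hW, hWC⟩ := X.hpath u hu h hh
  have := ((hp.append hT ry nKT).append (HP.single x) zx (by grind)).append hW hxu (by grind)
  exact X.cyc1 this hkh.symm (by grind) (u := u) (by have := hW.left_mem; grind) (X.hout u hu)

theorem zun (s : Seg G C x p r y z K T) (X : Ctx G C H) {u h : V} (hu : u ∈ H) (hh : h ∈ H)
    (hxu : G.Adj x u) : ¬ G.Adj z h := by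
  intro hkh
  obtain ⟨hK, hT, xK, ry, zx, xy, hC, nK, nT, nKT⟩ := id s
  obtain ⟨W, hW, hWC⟩ := X.hpath h hh u hu
  have := (((HP.single x).append hK (xK p hK.left_mem) (by grind)).append hT ry (by grind)).append hW hkh (by grind)
  exact X.cyc1 this hxu.symm (by grind) (u := u) (by have := hW.right_mem; grind) (X.hout u hu)

/-- The inductive part of the exclusion of an attached last vertex of `K`. -/
theorem chainA (X : Ctx G C H) {x p r u v z : V} (hu : u ∈ H) (hv : v ∈ H) (hxu : G.Adj x u)
    (hrv : G.Adj r v) (huv : G.Adj u v) (hxp : G.Adj x p) (hxr : G.Adj x r) (hpr : G.Adj p r)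
    (hru : ¬ G.Adj r u) (hxv : ¬ G.Adj x v) (hpH : ∀ h ∈ H, ¬ G.Adj p h) (hzx : G.Adj z x)
    (SP : ∀ q, q ≠ x → ¬ G.Adj x q → ¬ G.Adj p q) (k : ℕ) :
    ∀ (α β : V) (P T : Finset V), T.card ≤ k → HP G x α P → HP G β z T → G.Adj α β →
    (∀ t ∈ P, t ∉ T) → (∀ t, t ∈ C ↔ t ∈ P ∨ t ∈ T) → G.Adj α v → ¬ G.Adj α u → G.Adj x α →
    ¬ G.Adj p α → p ∈ P → r ∈ P → α ≠ p → α ≠ r → False := by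
  induction k with
  | zero =>
    intro α β P T hk _ hT
    have := hT.left_mem
    have := Finset.card_pos.2 ⟨_, this⟩
    omega
  | succ k ih =>
    intro α β P T hk hP hT hαβ hPT hC hαv hαu hxα hpα hpP hrP hαp hαr
    have hβT := hT.left_mem
    have hβH : ∀ h ∈ H, ¬ G.Adj β h := by
      intro h hh hβh
      obtain ⟨W, hW, hWC⟩ := X.hpath v hv h hh
      have := (hT.append hP hzx (by clear ih; grind)).append hW hαv (by clear ih; grind)
      exact X.cyc1 this hβh.symm (by clear ih; grind) (u := v) (by have := hW.left_mem; clear ih; grind) (X.hout v hv)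
    have hzH : ∀ h ∈ H, ¬ G.Adj z h := by
      intro h hh hzh
      obtain ⟨W, hW, hWC⟩ := X.hpath h hh u hu
      have := (hP.append hT hαβ (by clear ih; grind)).append hW hzh (by clear ih; grind)
      exact X.cyc1 this hxu.symm (by clear ih; grind) (u := u) (by have := hW.right_mem; clear ih; grind) (X.hout u hu)
    have hxP := hP.left_mem
    have hrα : ¬ G.Adj r α := fun h => hpα (X.k4 x r p α hxr hxp hxα hpr.symm h (Ne.symm hαp))
    have hβH' := hβH v hv
    have hβHu := hβH u hu
    have hpv := hpH v hv
    have hpu := hpH u hu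
    have hαP := hP.right_mem
    have hβp : β ≠ p := by rintro rfl; exact hPT _ hpP hβT
    have hβr : β ≠ r := by rintro rfl; exact hPT _ hrP hβT
    have hβx0 : β ≠ x := by rintro rfl; exact hPT _ hxP hβT
    have hβx : ¬ G.Adj x β := by
      intro hxβ
      have h1 : ¬ G.Adj p β := fun h => hpα (X.k4x x β p α)
      have h2 : ¬ G.Adj r β := fun h => h1 (X.k4x x r p β)
      exact X.p5x p r v α β
    have hβp' : ¬ G.Adj p β := SP β hβx0 hβx
    have hrβ : G.Adj r β := by
      by_contra hrβ
      exact X.p5x p r v α β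
    rcases hT.inv with ⟨e, _⟩ | ⟨γ, T1, hβγ, hT1, hβT1, hTT1⟩
    · subst e; exact absurd hzx.symm hβx
    have hγT1 := hT1.left_mem
    have hγT : γ ∈ T := (hTT1 γ).2 (Or.inr hγT1)
    have hγp : γ ≠ p := by rintro rfl; exact hPT _ hpP hγT
    have hγx : γ ≠ x := by rintro rfl; exact hPT _ hxP hγT
    have hγα : γ ≠ α := by rintro rfl; exact hPT _ hαP hγT
    have hγr : γ ≠ r := by rintro rfl; exact hPT _ hrP hγT
    have hxγ : G.Adj x γ := by
      by_contra hxγ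
      have hpγ := SP γ hγx hxγ
      have hαγ : G.Adj α γ := by
        by_contra hαγ
        exact X.p5x p x α β γ
      have hγv : ¬ G.Adj γ v := fun h => hβH' (X.k4x α γ β v (hne := by
        rintro rfl; exact X.hout _ hv ((hC _).2 (Or.inr hβT))))
      have hrγ : G.Adj r γ := by
        by_contra hrγ
        exact X.p5x p r v α γ
      exact hrα (X.k4x β γ r α)
    have hαγ : ¬ G.Adj α γ := fun h => hβx (X.k4x α γ x β)
    have hpγ : ¬ G.Adj p γ := by
      intro h
      have h1 := X.k4x x p r γ
      exact hβx (X.k4x r γ x β)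
    have hrγ : ¬ G.Adj r γ := fun h => hpγ (X.k4x x r p γ)
    have hγu : ¬ G.Adj γ u := by
      intro h
      exact X.p5x p r β γ u
    have hγv : G.Adj γ v := by
      by_contra hγv
      exact X.p5x u v α β γ
    rcases hT1.inv with ⟨e, _⟩ | ⟨δ, T2, hγδ, hT2, hγT2, hTT2⟩
    · subst e; exact hzH v hv hγv
    have hP' := (hP.append (HP.single β) hαβ (by clear ih; grind)).append (HP.single γ) hβγ
      (by clear ih; grind)
    refine ih γ δ _ T2 ?_ hP' hT2 hγδ (by clear ih; grind) (by clear ih; grind) hγv hγu hxγ hpγ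
      (by clear ih; grind) (by clear ih; grind) hγp hγr
    have : T2 ⊂ T := ⟨by intro t; clear ih; grind, by intro h; have := h hβT; clear ih; grind⟩
    have := Finset.card_lt_card this
    omega

end Seg

namespace Seg
variable {G : SimpleGraph V} {C : Finset V} {H : Set V} {x p r y z : V} {K T : Finset V}

/-- `x` and `r` cannot be attached to the two ends of an edge of `H`. -/
theorem aprime (s : Seg G C x p r y z K T) (X : Ctx G C H) (hpr : p ≠ r) {u v : V} (hu : u ∈ H)
    (hv : v ∈ H) (huv : G.Adj u v) (hxu : G.Adj x u) (hrv : G.Adj r v) : False := by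
  obtain ⟨hK, hT, xK, ry, zx, xy, hC, nK, nT, nKT⟩ := id s
  have hpK := hK.left_mem
  have hrK := hK.right_mem
  have hyT := hT.left_mem
  have hzT := hT.right_mem
  have huC := X.hout u hu
  have hvC := X.hout v hv
  have hxp := xK p hpK
  have hxr := xK r hrK
  have hpr' := s.cl X p hpK r hrK hpr
  have hkH : ∀ k ∈ K, k ≠ r → ∀ h ∈ H, ¬ G.Adj k h := fun k hk hkr h hh =>
    s.unatt X hu hh hxu hk (Or.inl hkr)
  have hzH : ∀ h ∈ H, ¬ G.Adj z h := fun h hh => s.zun X hu hh hxu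
  have hpu := hkH p hpK hpr u hu
  have hpv := hkH p hpK hpr v hv
  have hKC : ∀ k ∈ K, k ∈ C := fun k hk => (hC k).2 (Or.inr (Or.inl hk))
  have hTC : ∀ k ∈ T, k ∈ C := fun k hk => (hC k).2 (Or.inr (Or.inr hk))
  have hxC : x ∈ C := (hC x).2 (Or.inl rfl)
  have hneC : ∀ {k h}, k ∈ C → h ∈ H → k ≠ h := fun hk hh e => X.hout _ hh (e ▸ hk)
  have hneKT : ∀ {k h}, k ∈ K → h ∈ T → k ≠ h := fun hk hh e => nKT _ hk (e ▸ hh)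
  have hnxT : ∀ {h}, h ∈ T → x ≠ h := fun hh e => nT (e ▸ hh)
  have hru : ¬ G.Adj r u := fun h => hpu (X.k4x x r p u (hne := hneC (hKC p hpK) hu))
  have hxv : ¬ G.Adj x v := fun h => hpv (X.k4x x r p v (hne := hneC (hKC p hpK) hv))
  have hthird : ∃ p' ∈ K, p' ≠ p ∧ p' ≠ r := by
    by_contra hcon
    push Not at hcon
    have := ((((HP.single x).append (HP.single u) hxu (by grind)).append (HP.single v) huv
      (by grind)).append (HP.single r) hrv.symm (by grind)).append hT ry (by grind)
    exact X.cyc2 (d := p) this zx (by grind) (u := u) (by grind) huC (v := v) (by grind) hvC huv.ne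
  have hyk : ∀ k ∈ K, k ≠ r → ¬ G.Adj k y := by
    intro k hk hkr h
    have h1 := s.cl X k hk r hrK hkr
    have h2 := xK k hk
    exact xy (X.k4x k r x y (hne := hnxT hyT))
  have SP : ∀ k ∈ K, k ≠ r → ∀ q, q ≠ x → ¬ G.Adj x q → ¬ G.Adj k q := by
    intro k hk hkr q hqx hxq hkq
    have hxk := xK k hk
    have hkr' := s.cl X k hk r hrK hkr
    have hqK : q ∉ K := fun h => hxq (xK q h)
    obtain ⟨k', hk', hk'r, hkk'⟩ : ∃ k' ∈ K, k' ≠ r ∧ k' ≠ k := by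
      obtain ⟨p', h1, h2, h3⟩ := hthird
      by_cases e : p = k
      · exact ⟨p', h1, h3, e ▸ h2⟩
      · exact ⟨p, hpK, hpr, e⟩
    have hk'k' := s.cl X k' hk' k hk hkk'
    have hk'r' := s.cl X k' hk' r hrK hk'r
    have hxk' := xK k' hk'
    have hk'q : ¬ G.Adj k' q := fun h => hxq (X.k4x k k' x q)
    have hrq : ¬ G.Adj r q := fun h => hxq (X.k4x k r x q)
    have a1 := hkH k hk hkr u hu
    have a2 := hkH k hk hkr v hv
    have a3 := hkH k' hk' hk'r u hu
    have a4 := hkH k' hk' hk'r v hv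
    have hq : G.Adj u q ∨ G.Adj v q := by
      by_contra hcon
      push Not at hcon
      obtain ⟨h1, h2⟩ := hcon
      exact X.p5x v u x k q
    have hqC : q ∈ C := by
      by_contra hqC
      rcases hq with h | h
      · exact hkH k hk hkr q (X.hcl u hu q h hqC) hkq
      · exact hkH k hk hkr q (X.hcl v hv q h hqC) hkq
    have hqT : q ∈ T := by
      rcases (hC q).1 hqC with h | h | h
      · exact absurd h hqx
      · exact absurd h hqK
      · exact h
    by_cases huq : G.Adj u q
    · by_cases hvq : G.Adj v q
      · have hqz : q ≠ z := by rintro rfl; exact hzH u hu huq.symm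
        obtain ⟨t, T1, T2, hT1, hqt, hT2, hd, hTT⟩ := hT.split q hqT hqz
        have htT2 := hT2.left_mem
        have htT : t ∈ T := (hTT t).2 (Or.inr htT2)
        have htH : ∀ h ∈ H, ¬ G.Adj t h := by
          intro h hh hth
          obtain ⟨W, hW, hWC⟩ := X.hpath u hu h hh
          have := (((hT2.append (HP.single x) zx (by grind)).append hK hxp (by grind)).append
            hT1 ry (by grind)).append hW huq.symm (by grind)
          exact X.cyc1 this hth.symm (by grind) (u := u) (by have := hW.left_mem; grind) huC
        have hk't : ¬ G.Adj k' t := by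
          intro hk't
          have := ((((HP.single x).append (HP.single u) hxu (by grind)).append hT1.symm huq
            (by grind)).append (s.path X hrK hk' hk'r.symm) ry.symm (by grind)).append hT2 hk't
            (by grind)
          exact X.cyc1 this zx (by grind) (u := u) (by grind) huC
        have b1 := htH u hu
        have b2 := htH v hv
        have hrt : G.Adj r t := by
          by_contra hrt
          exact X.p5x k' r v q t
        have hxt : G.Adj x t := by
          by_contra hxt
          exact X.p5x k' x u q t
        exact hk't (X.k4x x r k' t (hne := hneKT hk' htT))
      · exact X.p5x k' k q u v
    · have hvq : G.Adj v q := hq.resolve_left huq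
      exact X.p5x k' k q v u
  have hyx := hnxT hyT
  rcases hT.splitP (fun t => G.Adj r t) ry with hall | ⟨l, w, K2, T2, hK2, hlw, hT2, hrK2, hrw, hd, hTT⟩
  · have hrz := hall z hzT
    by_cases hzy : z = y
    · exact xy (hzy ▸ zx.symm)
    · have hyz := X.nbr_clique hT hall z hzT y hyT hzy
      exact xy (X.k4x r z x y)
  · have hyK2 := hK2.left_mem
    have hlK2 := hK2.right_mem
    have hwT2 := hT2.left_mem
    have hwT : w ∈ T := (hTT w).2 (Or.inr hwT2)
    have hlT : l ∈ T := (hTT l).2 (Or.inl hlK2)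
    have hrl : G.Adj r l := hrK2 l hlK2
    have hyH : ∀ h ∈ H, ¬ G.Adj y h := by
      intro h hh hyh
      obtain ⟨W, hW, hWC⟩ := X.hpath v hv h hh
      have := ((hT.append (HP.single x) zx (by grind)).append hK hxp (by grind)).append hW hrv
        (by grind)
      exact X.cyc1 this hyh.symm (by grind) (u := v) (by have := hW.left_mem; grind) hvC
    have hyu := hyH u hu
    have hyv := hyH v hv
    have hly : l ≠ y → G.Adj l y := fun h => X.nbr_clique hK2 hrK2 l hlK2 y hyK2 h
    have hlv : ¬ G.Adj l v := by
      intro hlv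
      have hne : l ≠ y := by rintro rfl; exact hyv hlv
      have := hly hne
      exact hyv (X.k4x r l y v (hne := hneC (hTC y hyT) hv))
    have hxl : ¬ G.Adj x l := by
      intro hxl
      have hne : l ≠ y := by rintro rfl; exact xy hxl
      have := hly hne
      exact xy (X.k4x r l x y)
    have hpl : ¬ G.Adj p l := SP p hpK hpr l (hnxT hlT).symm hxl
    have hpy := hyk p hpK hpr
    have hlu : ¬ G.Adj l u := by
      intro hlu
      have hne : l ≠ y := by rintro rfl; exact hyu hlu
      have := hly hne
      exact X.p5x p x u l y
    have hpw : ¬ G.Adj p w := by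
      intro hpw
      have hxw : G.Adj x w := by
        by_contra hxw
        exact SP p hpK hpr w (hnxT hwT).symm hxw hpw
      exact hrw (X.k4x x p r w (hne := hneKT hrK hwT))
    have hwu : ¬ G.Adj w u := by
      intro hwu
      exact X.p5x p r l w u
    have hwv : G.Adj w v := by
      by_contra hwv
      exact X.p5x u v r l w
    have hxw : G.Adj x w := by
      by_contra hxw
      exact X.p5x p x u v w
    rcases hT2.inv with ⟨e, _⟩ | ⟨b, T3, hwb, hT3, hwT3, hTT3⟩
    · subst e; exact hzH v hv hwv
    have hP := (((HP.single x).append hK hxp (by grind)).append hK2 ry (by grind)).append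
      (HP.single w) hlw (by grind)
    exact chainA X hu hv hxu hrv huv hxp hxr hpr' hru hxv (hkH p hpK hpr) zx (SP p hpK hpr) _
      w b _ T3 le_rfl hP hT3 hwb (by grind) (by grind) hwv hwu hxw hpw (by grind) (by grind)
      (hneKT hpK hwT).symm (hneKT hrK hwT).symm

/-- All of `K` is unattached if it has at least two elements. -/
theorem run (s : Seg G C x p r y z K T) (X : Ctx G C H) {u : V} (hu : u ∈ H)
    (hxu : G.Adj x u) : ∀ k ∈ K, ∀ h ∈ H, ¬ G.Adj k h := by
  intro k hk h hh
  by_cases hkr : k ≠ r ∨ k = p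
  · exact s.unatt X hu hh hxu hk hkr
  push Not at hkr
  obtain ⟨rfl, hpr⟩ := hkr
  intro hkh
  obtain ⟨hK, hT, xK, ry, zx, xy, hC, nK, nT, nKT⟩ := id s
  have hpK := hK.left_mem
  have hxp := xK p hpK
  have hxk := xK k hk
  have hpk := s.cl X p hpK k hk hpr.symm
  have hpH : ∀ h ∈ H, ¬ G.Adj p h := fun h hh => s.unatt X hu hh hxu hpK (Or.inr rfl)
  have key : ∀ h ∈ H, G.Adj x h ∨ ∃ g ∈ H, G.Adj x g ∧ G.Adj g h := by
    refine X.hind (fun h => G.Adj x h ∨ ∃ g ∈ H, G.Adj x g ∧ G.Adj g h) u hu (Or.inl hxu) ?_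
    rintro a ha b hb hab (h1 | ⟨g, hg, h1, h2⟩)
    · exact Or.inr ⟨a, ha, h1, hab⟩
    · by_contra hcon
      push Not at hcon
      obtain ⟨c1, c2⟩ := hcon
      have c3 := c2 g hg h1
      have d1 := hpH a ha
      have d2 := hpH b hb
      have d3 := hpH g hg
      have c4 : ¬ G.Adj x a := fun h => c2 a ha h hab
      exact X.p5x p x g a b
  have hxh : ¬ G.Adj x h := by
    intro hxh
    have hne : p ≠ h := by rintro rfl; exact X.hout _ hh ((hC _).2 (Or.inr (Or.inl hpK)))
    exact hpH h hh (X.k4x x k p h)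
  rcases key h hh with h1 | ⟨g, hg, h1, h2⟩
  · exact hxh h1
  · exact s.aprime X hpr.symm hg hh h2 h1 hkh

end Seg

namespace Seg
variable {G : SimpleGraph V} {C : Finset V} {H : Set V} {x p r y z : V} {K T : Finset V}

theorem ps1 (s : Seg G C x p r y z K T) (X : Ctx G C H) {u v : V} (hu : u ∈ H)
    (hv : v ∈ H) (huv : G.Adj u v) (hxu : G.Adj x u) (hxv : ¬ G.Adj x v) :
    G.Adj y u ∧ ((p = r ∧ ∀ h ∈ H, G.Adj y h → h = u) ∨
      (p ≠ r ∧ (∀ h ∈ H, G.Adj y h) ∧ ∀ g ∈ H, ∀ h ∈ H, g ≠ h → G.Adj g h)) := by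
  have hKH := s.run X hu hxu
  obtain ⟨hK, hT, xK, ry, zx, xy, hC, nK, nT, nKT⟩ := id s
  have hpK := hK.left_mem
  have hrK := hK.right_mem
  have hyT := hT.left_mem
  have huC := X.hout u hu
  have hvC := X.hout v hv
  have hxp := xK p hpK
  have hxr := xK r hrK
  have hru := hKH r hrK u hu
  have hrv := hKH r hrK v hv
  have hpu := hKH p hpK u hu
  have hpv := hKH p hpK v hv
  have hxy : x ≠ y := fun e => nT (e ▸ hyT)
  have hxC : x ∈ C := (hC x).2 (Or.inl rfl)
  have hpy : p ≠ r → ¬ G.Adj p y := by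
    intro hpr h
    have h1 := s.cl X p hpK r hrK hpr
    exact xy (X.k4x p r x y)
  have hyu : G.Adj y u := by
    by_contra hyu
    have hyv : G.Adj y v := by
      by_contra hyv
      exact X.p5x v u x r y
    by_cases hpr : p = r
    · subst hpr
      have hself := hK.self_eq
      have := (((HP.single x).append (HP.single u) hxu (by grind)).append (HP.single v) huv
        (by grind)).append hT hyv.symm (by grind)
      exact X.cyc2 (d := p) this zx (by grind) (u := u) (by grind) huC (v := v) (by grind) hvC huv.ne
    · have := hpy hpr
      exact X.p5x p x u v y
  refine ⟨hyu, ?_⟩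
  by_cases hpr : p = r
  · left
    refine ⟨hpr, ?_⟩
    intro h hh hyh
    by_contra hhu
    subst hpr
    have hself := hK.self_eq
    obtain ⟨W, hW, hWC⟩ := X.hpath u hu h hh
    have h1 := hW.left_mem
    have h2 := hW.right_mem
    have := ((HP.single x).append hW hxu (by grind)).append hT hyh.symm (by grind)
    exact X.cyc2 (d := p) this zx (by grind) (u := u) (by grind) huC (v := h) (by grind)
      (X.hout h hh) (Ne.symm hhu)
  · right
    have h1 := hpy hpr
    have h2 := s.cl X p hpK r hrK hpr
    have hall : ∀ h ∈ H, G.Adj y h := by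
      refine X.hind (fun h => G.Adj y h) u hu hyu ?_
      intro a ha b hb hab hya
      by_contra hyb
      have b1 := hKH r hrK a ha
      have b2 := hKH r hrK b hb
      have b3 := hKH p hpK a ha
      have b4 := hKH p hpK b hb
      exact X.p5x p r y a b
    refine ⟨hpr, hall, ?_⟩
    intro g hg h hh hgh
    refine (X.hind (fun h => h = g ∨ G.Adj g h) g hg (Or.inl rfl) ?_ h hh).resolve_left hgh.symm
    rintro a ha b hb hab (rfl | hga)
    · exact Or.inr hab
    · by_cases hbg : b = g
      · exact Or.inl hbg
      · right
        have := hall a ha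
        have := hall b hb
        have := hall g hg
        exact X.k4x y a g b

end Seg

/-- `C` is `x`, a path `p … r` (`K`) in `N(x)`, a path `y … y'` (`M`), a path `r' … z` (`K'`) in `N(x)`. -/
structure Two (G : SimpleGraph V) (C : Finset V) (x p r y y' r' z : V) (K M K' : Finset V) : Prop where
  hK : HP G p r K
  hM : HP G y y' M
  hK' : HP G r' z K'
  xK : ∀ t ∈ K, G.Adj x t
  xK' : ∀ t ∈ K', G.Adj x t
  ry : G.Adj r y
  yr' : G.Adj y' r'
  xy : ¬ G.Adj x y
  xy' : ¬ G.Adj x y'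
  hC : ∀ t, t ∈ C ↔ t = x ∨ t ∈ K ∨ t ∈ M ∨ t ∈ K'
  nK : x ∉ K
  nM : x ∉ M
  nK' : x ∉ K'
  nKM : ∀ t ∈ K, t ∉ M
  nKK' : ∀ t ∈ K, t ∉ K'
  nMK' : ∀ t ∈ M, t ∉ K'

namespace Two
variable {G : SimpleGraph V} {C : Finset V} {H : Set V} {x p r y y' r' z : V} {K M K' : Finset V}

theorem rev (s : Two G C x p r y y' r' z K M K') : Two G C x z r' y' y r p K' M K := by
  obtain ⟨hK, hM, hK', xK, xK', ry, yr', xy, xy', hC, nK, nM, nK', nKM, nKK', nMK'⟩ := s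
  refine ⟨hK'.symm, hM.symm, hK.symm, xK', xK, yr'.symm, ry.symm, xy', xy, ?_, nK', nM, nK, ?_, ?_, ?_⟩
  all_goals grind

theorem fwd (s : Two G C x p r y y' r' z K M K') : Seg G C x p r y z K (M ∪ K') := by
  obtain ⟨hK, hM, hK', xK, xK', ry, yr', xy, xy', hC, nK, nM, nK', nKM, nKK', nMK'⟩ := s
  refine ⟨hK, hM.append hK' yr' nMK', xK, ry, (xK' z hK'.right_mem).symm, xy, ?_, nK, ?_, ?_⟩
  all_goals grind

/-- (many, one) is impossible -/
theorem ba (s : Two G C x p r y y' r' z K M K') (X : Ctx G C H) {u v : V} (hu : u ∈ H)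
    (hv : v ∈ H) (huv : G.Adj u v) (hxu : G.Adj x u) (hpr : p ≠ r)
    (hy : ∀ h ∈ H, G.Adj y h) (hzr : z = r') (hy'u : G.Adj y' u)
    (hy' : ∀ h ∈ H, G.Adj y' h → h = u) : False := by
  have hKH := s.fwd.run X hu hxu
  obtain ⟨hK, hM, hK', xK, xK', ry, yr', xy, xy', hC, nK, nM, nK', nKM, nKK', nMK'⟩ := id s
  have hpK := hK.left_mem
  have hrK := hK.right_mem
  have hyM := hM.left_mem
  have hy'M := hM.right_mem
  have huC := X.hout u hu
  have hvC := X.hout v hv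
  have hxp := xK p hpK
  have hxr := xK r hrK
  have hru := hKH r hrK u hu
  have hpu := hKH p hpK u hu
  have hpr' := s.fwd.cl X p hpK r hrK hpr
  have hyu := hy u hu
  have hyv := hy v hv
  have hy'v : ¬ G.Adj y' v := fun h => huv.ne (hy' v hv h).symm
  have hy'C : y' ∈ C := (hC y').2 (by tauto)
  have hxy : x ≠ y := fun e => nM (e ▸ hyM)
  have hyy' : ¬ G.Adj y y' := fun h => hy'v (X.k4x y u y' v (hne := by rintro rfl; exact hvC hy'C))
  have hpy : ¬ G.Adj p y := fun h => xy (X.k4x p r x y)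
  have key : ∃ k ∈ K, ∃ e ∈ K, k ≠ e ∧ G.Adj y' k := by
    by_cases h1 : G.Adj y' r
    · exact ⟨r, hrK, p, hpK, hpr.symm, h1⟩
    · by_cases h2 : G.Adj y' p
      · exact ⟨p, hpK, r, hrK, hpr, h2⟩
      · exact (X.p5x y' u y r p).elim
  obtain ⟨k, hk, e, he, hke, hy'k⟩ := key
  subst hzr
  have hself := hK'.self_eq
  have hxC : x ∈ C := (hC x).2 (by tauto)
  have := ((((s.fwd.path X hk he hke).append (HP.single x) (xK e he).symm (by grind)).append
    (HP.single u) hxu (by grind)).append (HP.single v) huv (by grind)).append hM hyv.symm (by grind)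
  exact X.cyc2 (d := z) this hy'k (by grind) (u := u) (by grind) huC (v := v) (by grind) hvC huv.ne

theorem noedge (s : Two G C x p r y y' r' z K M K') (X : Ctx G C H) {u v : V} (hu : u ∈ H)
    (hv : v ∈ H) (huv : G.Adj u v) (hxu : G.Adj x u) (hpr : p ≠ r) (hyv : G.Adj y v)
    {k k' : V} (hk : k ∈ K) (hk' : k' ∈ K') (hne : k' ≠ r') : ¬ G.Adj k k' := by
  intro hkk'
  obtain ⟨hK, hM, hK', xK, xK', ry, yr', xy, xy', hC, nK, nM, nK', nKM, nKK', nMK'⟩ := id s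
  have huC := X.hout u hu
  have hvC := X.hout v hv
  have hxC : x ∈ C := (hC x).2 (by tauto)
  have huv' := huv.ne
  obtain ⟨e, he, hke⟩ : ∃ e ∈ K, k ≠ e := by
    by_cases h : k = p
    · exact ⟨r, hK.right_mem, h ▸ hpr⟩
    · exact ⟨p, hK.left_mem, h⟩
  have := (((((s.rev.fwd.path X hK'.left_mem hk' hne.symm).append (s.fwd.path X hk he hke) hkk'.symm
    (by grind)).append (HP.single x) (xK e he).symm (by grind)).append
    (HP.single u) hxu (by grind)).append (HP.single v) huv (by intro t ht; have : v ∉ K := (by grind); have : v ∉ K' := (by grind); grind)).append hM hyv.symm (by grind)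
  exact X.cyc1 this yr' (by grind) (u := u) (by grind) huC

/-- (many, many) is impossible -/
theorem bb (s : Two G C x p r y y' r' z K M K') (X : Ctx G C H) {u v : V} (hu : u ∈ H)
    (hv : v ∈ H) (huv : G.Adj u v) (hxu : G.Adj x u) (hxv : ¬ G.Adj x v) (hpr : p ≠ r)
    (hy : ∀ h ∈ H, G.Adj y h) (hzr : z ≠ r') (hy' : ∀ h ∈ H, G.Adj y' h) : False := by
  have hKH := s.fwd.run X hu hxu
  have hK'H := s.rev.fwd.run X hu hxu
  obtain ⟨hK, hM, hK', xK, xK', ry, yr', xy, xy', hC, nK, nM, nK', nKM, nKK', nMK'⟩ := id s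
  have hpK := hK.left_mem
  have hrK := hK.right_mem
  have hyM := hM.left_mem
  have hy'M := hM.right_mem
  have hzK' := hK'.right_mem
  have hrK' := hK'.left_mem
  have huC := X.hout u hu
  have hvC := X.hout v hv
  have hxC : x ∈ C := (hC x).2 (by tauto)
  have hxp := xK p hpK
  have hxr := xK r hrK
  have hxr' := xK' r' hrK'
  have hxz := xK' z hzK'
  have hru := hKH r hrK u hu
  have hrv := hKH r hrK v hv
  have hpu := hKH p hpK u hu
  have hpv := hKH p hpK v hv
  have hr'u := hK'H r' hrK' u hu
  have hpr' := s.fwd.cl X p hpK r hrK hpr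
  have hzr' := s.rev.fwd.cl X z hzK' r' hrK' hzr
  have hyu := hy u hu
  have hyv := hy v hv
  have hy'u := hy' u hu
  have hy'v := hy' v hv
  have hxy : x ≠ y := fun e => nM (e ▸ hyM)
  have hxy' : x ≠ y' := fun e => nM (e ▸ hy'M)
  have e1 : ¬ G.Adj p z := s.noedge X hu hv huv hxu hpr hyv hpK hzK' hzr
  have e2 : ¬ G.Adj r z := s.noedge X hu hv huv hxu hpr hyv hrK hzK' hzr
  have e3 : ¬ G.Adj r' p := s.rev.noedge X hu hv huv hxu hzr hy'v hrK' hpK hpr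
  have e4 : ¬ G.Adj r r' := fun h => e3 (X.k4x x r p r' (hne := fun e => nKK' p hpK (e ▸ hrK'))).symm
  have hpy : ¬ G.Adj p y := fun h => xy (X.k4x p r x y)
  have hzy' : ¬ G.Adj z y' := fun h => xy' (X.k4x z r' x y')
  by_cases hyy' : y = y'
  · subst hyy'
    exact X.p5x p r y r' z
  have hyy : G.Adj y y' := X.k4x u v y y'
  have hry' : ¬ G.Adj r y' := fun h => hru (X.k4x y y' r u (hne := by rintro rfl; grind))
  have hr'y : ¬ G.Adj r' y := fun h => hr'u (X.k4x y y' r' u (hne := by rintro rfl; grind))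
  rcases hM.inv with ⟨e, _⟩ | ⟨m, M1, hym, hM1, hyM1, hMM⟩
  · exact hyy' e
  have hmM1 := hM1.left_mem
  have hKrp := s.fwd.path X hrK hpK hpr.symm
  by_cases hmy' : m = y'
  · subst hmy'
    have hself := hM1.self_eq
    have hpm : G.Adj p m := by
      by_contra hpm
      exact X.p5x p r y m r'
    have := (((((((HP.single x).append (HP.single u) hxu (by grind)).append (HP.single v) huv
      (by grind)).append (HP.single y) hyv.symm (by grind)).append hKrp ry.symm (by grind)).append
      hM1 hpm (by grind))).append hK' yr' (by grind)
    exact X.cyc1 this hxz.symm (by grind) (u := u) (by grind) huC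
  have hmH : ∀ h ∈ H, ¬ G.Adj m h := by
    intro h hh hmh
    have hhC := X.hout h hh
    have := ((((hM1.append hK' yr' (by grind)).append (HP.single x) hxz.symm (by grind)).append hK hxp
      (by grind)).append (HP.single y) ry (by grind)).append (HP.single h) (hy h hh) (by grind)
    exact X.cyc1 this hmh.symm (by grind) (u := h) (by grind) hhC
  have hmu := hmH u hu
  have hmv := hmH v hv
  have hmp : ¬ G.Adj m p := by
    intro hmp
    have := (((((((HP.single x).append (HP.single u) hxu (by grind)).append (HP.single v) huv
      (by grind)).append (HP.single y) hyv.symm (by grind)).append hKrp ry.symm (by grind)).append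
      hM1 hmp.symm (by grind))).append hK' yr' (by grind)
    exact X.cyc1 this hxz.symm (by grind) (u := u) (by grind) huC
  have hxm : ¬ G.Adj x m := by
    intro hxm
    exact X.p5x v y m x p
  have hmr : ¬ G.Adj m r := by
    intro hmr
    exact X.p5x v u x r m
  have hmr' : ¬ G.Adj m r' := by
    intro hmr'
    have := ((((hM1.symm.append hK' hmr' (by grind)).append (HP.single x) hxz.symm (by grind)).append hK hxp
      (by grind)).append (HP.single y) ry (by grind)).append (HP.single u) hyu (by grind)
    exact X.cyc1 this hy'u.symm (by grind) (u := u) (by grind) huC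
  exact X.p5x m y r x r'

theorem core (s : Two G C x p r y y' r' z K M K') (X : Ctx G C H) {u v : V} (hu : u ∈ H)
    (hv : v ∈ H) (huv : G.Adj u v) (hxu : G.Adj x u) (hxv : ¬ G.Adj x v) :
    p = r ∧ G.Adj y u ∧ (∀ h ∈ H, G.Adj y h → h = u) ∧ (∀ h ∈ H, G.Adj x h → h = u) := by
  obtain ⟨h1, h2⟩ := s.fwd.ps1 X hu hv huv hxu hxv
  obtain ⟨h3, h4⟩ := s.rev.fwd.ps1 X hu hv huv hxu hxv
  rcases h2 with ⟨a1, a2⟩ | ⟨a1, a2, _⟩ <;> rcases h4 with ⟨b1, b2⟩ | ⟨b1, b2, _⟩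
  · refine ⟨a1, h1, a2, ?_⟩
    intro h hh hxh
    by_contra hhu
    obtain ⟨hK, hM, hK', xK, xK', ry, yr', xy, xy', hC, nK, nM, nK', nKM, nKK', nMK'⟩ := id s
    subst b1
    have hself := hK'.self_eq
    have hxC : x ∈ C := (hC x).2 (by tauto)
    obtain ⟨W, hW, hWC⟩ := X.hpath u hu h hh
    have w1 := hW.left_mem
    have w2 := hW.right_mem
    have := (((HP.single x).append hK (xK p hK.left_mem) (by grind)).append hM ry (by grind)).append
      hW h3 (by grind)
    exact X.cyc2 (d := z) this hxh.symm (by grind) (u := u) (by grind) (X.hout u hu) (v := h)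
      (by grind) (X.hout h hh) (Ne.symm hhu)
  · exact (s.rev.ba X hu hv huv hxu b1 b2 a1 h1 a2).elim
  · exact (s.ba X hu hv huv hxu a1 a2 b1 h3 b2).elim
  · exact (s.bb X hu hv huv hxu hxv a1 a2 b1 b2).elim

end Two

theorem Seg.toTwo {G : SimpleGraph V} {C : Finset V} {x p r y z : V} {K T : Finset V}
    (s : Seg G C x p r y z K T) : ∃ y' r' M K', Two G C x p r y y' r' z K M K' := by
  obtain ⟨hK, hT, xK, ry, zx, xy, hC, nK, nT, nKT⟩ := id s
  rcases hT.symm.splitP (fun t => G.Adj x t) zx.symm with h | ⟨r', y', K', M, h1, h2, h3, h4, h5, h6, h7⟩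
  · exact absurd (h y hT.left_mem) xy
  · refine ⟨y', r', M, K', hK, h3.symm, h1.symm, xK, h4, ry, h2.symm, xy, h5, ?_, nK, ?_, ?_, ?_, ?_, ?_⟩
    all_goals grind

namespace Ctx
variable {G : SimpleGraph V} {C : Finset V} {H : Set V}

theorem notall (X : Ctx G C H) {x u p z : V} {S : Finset V} (hS : HP G p z S) (nx : x ∉ S)
    (hC : ∀ t, t ∈ C ↔ t = x ∨ t ∈ S) (hall : ∀ t ∈ S, G.Adj x t) (hu : u ∈ H)
    (hxu : G.Adj x u) : False := by
  have hcl := X.nbr_clique hS hall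
  have hpC : p ∈ C := (hC p).2 (Or.inr hS.left_mem)
  have huC := X.hout u hu
  have hxC : x ∈ C := (hC x).2 (Or.inl rfl)
  obtain ⟨a, b, ha, hax, hb, hbx, hab⟩ := X.two x H ⟨u, hu, hxu.symm.ne⟩
    ⟨p, fun h => X.hout p h hpC, fun e => nx (e ▸ hS.left_mem)⟩
  have hbC : b ∈ C := by
    by_contra h
    exact hb (X.hcl a ha b hab h)
  have hP : HP G x b C := by
    refine HP.clique _ C x b rfl ?_ hxC hbC hbx.symm
    intro s hs t ht hst
    rcases (hC s).1 hs with rfl | hs' <;> rcases (hC t).1 ht with rfl | ht'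
    · exact absurd rfl hst
    · exact hall t ht'
    · exact (hall s hs').symm
    · exact hcl s hs' t ht' hst
  obtain ⟨W, hW, hWC⟩ := X.hpath a ha u hu
  have w := hW.right_mem
  exact X.cyc1 (hP.append hW hab.symm (by grind)) hxu.symm (by grind) (u := u) (by grind) huC

theorem step (X : Ctx G C H) {u v a b c e : V} {T : Finset V} (hu : u ∈ H) (hv : v ∈ H)
    (huv : G.Adj u v) (hab : G.Adj a b) (hbc : G.Adj b c) (hT : HP G c e T) (hea : G.Adj e a)
    (haT : a ∉ T) (hbT : b ∉ T) (hC : ∀ t, t ∈ C ↔ t = a ∨ t = b ∨ t ∈ T) (hau : G.Adj a u)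
    (hav : ¬ G.Adj a v) :
    G.Adj c u ∧ (∀ h ∈ H, G.Adj c h → h = u) ∧ (∀ h ∈ H, G.Adj a h → h = u) := by
  have hne := hab.ne
  by_cases hac : G.Adj a c
  · exfalso
    rcases hT.splitP (fun t => G.Adj a t) hac with h | ⟨r, y, K, T1, h1, h2, h3, h4, h5, h6, h7⟩
    · have := (HP.single b).append hT hbc (by grind)
      exact X.notall this (x := a) (by grind) (by grind) (by grind) hu hau
    · have hK := (HP.single b).append h1 hbc (by grind)
      have s : Seg G C a b r y e ({b} ∪ K) T1 := by
        refine ⟨hK, h3, ?_, h2, hea, h5, ?_, ?_, ?_, ?_⟩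
        all_goals grind
      obtain ⟨y', r', M, K', s2⟩ := s.toTwo
      have := (s2.core X hu hv huv hau hav).1
      have := h1.right_mem
      grind
  · have s : Seg G C a b b c e {b} T := by
      refine ⟨HP.single b, hT, ?_, hbc, hea, hac, ?_, ?_, ?_, ?_⟩
      all_goals grind
    obtain ⟨y', r', M, K', s2⟩ := s.toTwo
    exact (s2.core X hu hv huv hau hav).2

theorem chainB (X : Ctx G C H) {u v : V} (hu : u ∈ H) (hv : v ∈ H) (huv : G.Adj u v) (k : ℕ) :
    ∀ (P T : Finset V) (a b z f : V), T.card ≤ k → HP G f a P → G.Adj a b → HP G b z T →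
    G.Adj z f → (∀ t ∈ P, t ∉ T) → (∀ t, t ∈ C ↔ t ∈ P ∨ t ∈ T) → G.Adj a u →
    (∀ h ∈ H, G.Adj a h → h = u) → ∀ t ∈ T, ∀ h ∈ H, G.Adj t h → h = u := by
  induction k with
  | zero =>
    intro P T a b z f hk _ _ hT
    have := hT.left_mem
    have := Finset.card_pos.2 ⟨_, this⟩
    omega
  | succ k ih =>
    intro P T a b z f hk hP hab hT hzf hPT hC hau haH
    have hbT := hT.left_mem
    have haP := hP.right_mem
    have huC := X.hout u hu
    have hbH : ∀ h ∈ H, ¬ G.Adj b h := by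
      intro h hh hbh
      obtain ⟨W, hW, hWC⟩ := X.hpath u hu h hh
      have w := hW.left_mem
      have := (hT.append hP hzf (by clear ih; grind)).append hW hau (by clear ih; grind)
      exact X.cyc1 this hbh.symm (by clear ih; grind) (u := u) (by clear ih; grind) huC
    rcases hT.inv with ⟨e, he⟩ | ⟨c, T1, hbc, hT1, hbT1, hTT1⟩
    · intro t ht h hh hth
      rw [he] at ht
      subst ht
      exact absurd hth (hbH h hh)
    have hcT1 := hT1.left_mem
    have hav : ¬ G.Adj a v := fun h => huv.ne (haH v hv h).symm
    have hc : G.Adj c u ∧ (∀ h ∈ H, G.Adj c h → h = u) ∧ (∀ h ∈ H, G.Adj a h → h = u) := by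
      rcases hP.symm.inv with ⟨e, he⟩ | ⟨w, P0, haw, hP0, haP0, hPP0⟩
      · subst e
        exact X.step hu hv huv hab hbc hT1 hzf (by clear ih; grind) hbT1 (by clear ih; grind) hau hav
      · have := hT1.append hP0.symm hzf (by clear ih; grind)
        exact X.step hu hv huv hab hbc this haw.symm (by clear ih; grind) (by clear ih; grind)
          (by clear ih; grind) hau hav
    have hP' := (hP.append (HP.single b) hab (by clear ih; grind)).append (HP.single c) hbc
      (by clear ih; grind)
    rcases hT1.inv with ⟨e, he⟩ | ⟨d, T2, hcd, hT2, hcT2, hTT2⟩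
    · intro t ht h hh hth
      rw [hTT1, he] at ht
      rcases ht with rfl | rfl
      · exact absurd hth (hbH h hh)
      · exact hc.2.1 h hh hth
    · have hlt : T2.card < T.card := by
        have : T2 ⊂ T := ⟨by intro t; clear ih; grind, by intro h; have := h hbT; clear ih; grind⟩
        exact Finset.card_lt_card this
      have := ih _ T2 c d z f (by omega) hP' hcd hT2 hzf (by clear ih; grind) (by clear ih; grind)
        hc.1 hc.2.1
      intro t ht h hh hth
      rw [hTT1, hTT2] at ht
      rcases ht with rfl | rfl | ht
      · exact absurd hth (hbH h hh)
      · exact hc.2.1 h hh hth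
      · exact this t ht h hh hth

theorem caseA (X : Ctx G C H) {u v x : V} (hu : u ∈ H) (hv : v ∈ H) (huv : G.Adj u v)
    (hx : x ∈ C) (hxu : G.Adj x u) : G.Adj x v := by
  by_contra hxv
  obtain ⟨p, z, S, hS, nx, hC, hxp, hzx, hpz⟩ := X.rot x hx
  have hxH : ∀ h ∈ H, G.Adj x h → h = u := by
    rcases hS.inv with ⟨e, he⟩ | ⟨c, T, hpc, hT, hpT, hST⟩
    · exact absurd e hpz
    · exact (X.step hu hv huv hxp hpc hT hzx (by grind) hpT (by grind) hxu hxv).2.2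
  have key := X.chainB hu hv huv _ {x} S x p z x le_rfl (HP.single x) hxp hS hzx (by grind) (by grind)
    hxu hxH
  obtain ⟨a, b, ha, hau, hb, hbu, hab⟩ := X.two u H ⟨v, hv, huv.symm.ne⟩
    ⟨x, fun h => X.hout x h hx, hxu.ne⟩
  have hbC : b ∈ C := by
    by_contra h
    exact hb (X.hcl a ha b hab h)
  rcases (hC b).1 hbC with rfl | h
  · exact hau (hxH a ha hab.symm)
  · exact hau (key b h a ha hab.symm)

end Ctx

/-- Case B: every attached vertex of `C` is complete to `H`. -/
structure CB (G : SimpleGraph V) (C : Finset V) (H : Set V) (u v : V) : Prop where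
  X : Ctx G C H
  hu : u ∈ H
  hv : v ∈ H
  huv : G.Adj u v
  comp : ∀ x ∈ C, ∀ g ∈ H, G.Adj x g → ∀ h ∈ H, G.Adj x h

/-- The attached vertices of `C`. -/
def Att (G : SimpleGraph V) (C : Finset V) (v x : V) : Prop := x ∈ C ∧ G.Adj x v

/-- The other neighbours of an attached vertex. -/
def Nb (G : SimpleGraph V) (C : Finset V) (H : Set V) (v x b : V) : Prop :=
  b ∉ H ∧ ¬ Att G C v b ∧ G.Adj x b

/-- The remaining vertices. -/
def Rm (G : SimpleGraph V) (C : Finset V) (H : Set V) (v w : V) : Prop :=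
  w ∉ H ∧ ¬ Att G C v w ∧ ∀ x, Att G C v x → ¬ G.Adj x w

namespace CB
variable {G : SimpleGraph V} {C : Finset V} {H : Set V} {u v : V}

theorem full (s : CB G C H u v) {x h : V} (hx : Att G C v x) (hh : h ∈ H) : G.Adj x h :=
  s.comp x hx.1 v s.hv hx.2 h hh

theorem noH (s : CB G C H u v) {b h : V} (hb : b ∉ H) (hA : ¬ Att G C v b) (hh : h ∈ H) :
    ¬ G.Adj b h := by
  intro hbh
  by_cases hbC : b ∈ C
  · exact hA ⟨hbC, s.comp b hbC h hh hbh v s.hv⟩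
  · exact hb (s.X.hcl h hh b hbh.symm hbC)

theorem cliq (s : CB G C H u v) {x y : V} (hx : Att G C v x) (hy : Att G C v y) (hne : x ≠ y) :
    G.Adj x y := by
  have h1 := s.full hx s.hu
  have h2 := s.full hy s.hu
  have h3 := hx.2
  have h4 := hy.2
  have h5 := s.huv
  exact s.X.k4x u v x y

theorem uniq (s : CB G C H u v) {x y b : V} (hx : Att G C v x) (hy : Att G C v y) (hne : x ≠ y)
    (hb : Nb G C H v x b) : ¬ G.Adj y b := by
  intro h
  have h1 := s.cliq hx hy hne
  have h2 := hb.2.2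
  have h3 := hx.2
  have h4 := hy.2
  exact s.noH hb.1 hb.2.1 s.hv (s.X.k4x x y b v (hne := by rintro rfl; exact hb.1 s.hv))

theorem other (s : CB G C H u v) {x : V} (hx : x ∈ C) : ∃ y, Att G C v y ∧ y ≠ x := by
  have hxv : v ≠ x := by rintro rfl; exact s.X.hout _ s.hv hx
  obtain ⟨p, z, S, hS, nx, hC, hxp, hzx, hpz⟩ := s.X.rot x hx
  have hpC : p ∈ C := (hC p).2 (Or.inr hS.left_mem)
  obtain ⟨a, b, ha, hax, hb, hbx, hab⟩ := s.X.two x H ⟨v, s.hv, hxv⟩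
    ⟨p, fun h => s.X.hout p h hpC, hxp.symm.ne⟩
  have hbC : b ∈ C := by
    by_contra h
    exact hb (s.X.hcl a ha b hab h)
  exact ⟨b, ⟨hbC, s.comp b hbC a ha hab.symm v s.hv⟩, hbx⟩

theorem exA (s : CB G C H u v) : ∃ y, Att G C v y := by
  have hne := s.huv.ne
  have h1 : HP G u v ({u} ∪ {v}) := (HP.single u).append (HP.single v) s.huv (by grind)
  have hC : C.Nonempty := by
    by_contra hC
    rw [Finset.not_nonempty_iff_eq_empty] at hC
    refine s.X.mx _ _ _ h1 s.huv.symm ?_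
    rw [hC, Finset.card_empty]
    exact Finset.card_pos.2 ⟨u, by simp⟩
  obtain ⟨x, hx⟩ := hC
  obtain ⟨y, hy, _⟩ := s.other hx
  exact ⟨y, hy⟩

/-- The successor of an attached vertex. -/
theorem succN (s : CB G C H u v) {x p z : V} {S : Finset V} (hx : Att G C v x) (hS : HP G p z S)
    (nx : x ∉ S) (hC : ∀ t, t ∈ C ↔ t = x ∨ t ∈ S) (hxp : G.Adj x p) (hzx : G.Adj z x) :
    Nb G C H v x p := by
  have hpC : p ∈ C := (hC p).2 (Or.inr hS.left_mem)
  have hvC := s.X.hout v s.hv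
  have hxC := hx.1
  refine ⟨fun h => s.X.hout p h hpC, fun hA => ?_, hxp⟩
  have := (hS.append (HP.single x) hzx (by grind)).append (HP.single v) hx.2 (by grind)
  exact s.X.cyc1 this hA.2.symm (by grind) (u := v) (by grind) hvC

theorem nbr2 (s : CB G C H u v) {x : V} (hx : Att G C v x) :
    ∃ p z, Nb G C H v x p ∧ Nb G C H v x z ∧ p ≠ z := by
  obtain ⟨p, z, S, hS, nx, hC, hxp, hzx, hpz⟩ := s.X.rot x hx.1
  exact ⟨p, z, s.succN hx hS nx hC hxp hzx, s.succN hx hS.symm nx hC hzx.symm hxp.symm, hpz⟩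

theorem sub1 (s : CB G C H u v) {x y a a' n : V} (hx : Att G C v x) (hy : Att G C v y)
    (hxy : x ≠ y) (ha : Nb G C H v x a) (ha' : Nb G C H v x a') (haa : G.Adj a a')
    (hn : Nb G C H v y n) : ¬ G.Adj a n := by
  intro han
  have h1 := s.uniq hx hy hxy ha
  have h2 := s.uniq hx hy hxy ha'
  have h3 := s.uniq hy hx hxy.symm hn
  have h4 := s.noH ha.1 ha.2.1 s.hv
  have h5 := s.noH ha'.1 ha'.2.1 s.hv
  have h6 := s.noH hn.1 hn.2.1 s.hv
  have h7 := ha.2.2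
  have h8 := ha'.2.2
  have h9 := hn.2.2
  have h10 := hy.2
  have h11 : x ≠ n := by rintro rfl; exact hn.2.1 hx
  have h12 : G.Adj a' n := by
    by_contra h
    exact s.X.p5x a' a n y v
  exact h3 (s.X.k4x a a' x n)

theorem indep (s : CB G C H u v) {x b b' : V} (hx : Att G C v x) (hb : Nb G C H v x b)
    (hb' : Nb G C H v x b') : ¬ G.Adj b b' := by
  intro hbb
  obtain ⟨a, c, ⟨ha, a', ha', haa⟩, hax, hc, hcx, hac⟩ := s.X.two x
    {b | Nb G C H v x b ∧ ∃ b', Nb G C H v x b' ∧ G.Adj b b'} ⟨b, ⟨hb, b', hb', hbb⟩, hb.2.2.symm.ne⟩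
    ⟨v, fun h => h.1.1 s.hv, hx.2.symm.ne⟩
  have hcH : c ∉ H := fun h => s.noH ha.1 ha.2.1 h hac
  have hcA : ¬ Att G C v c := fun h => s.uniq hx h hcx.symm ha hac.symm
  have hxc : ¬ G.Adj x c := fun h => hc ⟨⟨hcH, hcA, h⟩, a, ha, hac.symm⟩
  by_cases hR : ∃ y, Att G C v y ∧ G.Adj y c
  · obtain ⟨y, hy, hyc⟩ := hR
    have hxy : x ≠ y := by rintro rfl; exact hxc hyc
    exact s.sub1 hx hy hxy ha ha' haa ⟨hcH, hcA, hyc⟩ hac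
  · push Not at hR
    obtain ⟨y, hy, hyx⟩ := s.other hx.1
    obtain ⟨n, _, hn, _, _⟩ := s.nbr2 hy
    have h1 := s.sub1 hx hy hyx.symm ha ha' haa hn
    have h2 := s.sub1 hx hy hyx.symm ha' ha haa.symm hn
    have h3 := hR y hy
    have h4 := ha.2.2
    have h5 := ha'.2.2
    have h6 := hn.2.2
    have h7 := s.cliq hx hy hyx.symm
    have h8 := s.uniq hx hy hyx.symm ha
    have h9 := s.uniq hx hy hyx.symm ha'
    have h10 := s.uniq hy hx hyx hn
    have hcn : G.Adj c n := by
      by_contra h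
      exact s.X.p5x c a x y n
    have hca : G.Adj c a' := by
      by_contra h
      exact s.X.p5x c n y x a'
    exact hxc (s.X.k4x a a' x c)

theorem Rcomp1 (s : CB G C H u v) {w x y n m : V} (hw : Rm G C H v w) (hx : Att G C v x)
    (hy : Att G C v y) (hxy : x ≠ y) (hn : Nb G C H v x n) (hwn : G.Adj w n)
    (hm : Nb G C H v y m) : G.Adj w m := by
  by_contra hwm
  have h1 := hw.2.2 x hx
  have h2 := hw.2.2 y hy
  have h3 := s.uniq hx hy hxy hn
  have h4 := s.uniq hy hx hxy.symm hm
  have h5 := hn.2.2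
  have h6 := hm.2.2
  have h7 := s.cliq hx hy hxy
  have h8 := s.noH hw.1 hw.2.1 s.hv
  have h9 := s.noH hn.1 hn.2.1 s.hv
  have h10 := s.noH hm.1 hm.2.1 s.hv
  have h11 := hy.2
  by_cases hmn : G.Adj m n
  · exact s.X.p5x v y m n w
  · exact s.X.p5x w n x y m

theorem Rcomp (s : CB G C H u v) {w x y n m : V} (hw : Rm G C H v w) (hx : Att G C v x)
    (hy : Att G C v y) (hn : Nb G C H v x n) (hwn : G.Adj w n)
    (hm : Nb G C H v y m) : G.Adj w m := by
  by_cases hxy : x = y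
  · subst hxy
    obtain ⟨y, hy, hyx⟩ := s.other hx.1
    obtain ⟨m', _, hm', _, _⟩ := s.nbr2 hy
    exact s.Rcomp1 hw hy hx hyx hm' (s.Rcomp1 hw hx hy hyx.symm hn hwn hm') hm
  · exact s.Rcomp1 hw hx hy hxy hn hwn hm

theorem Rindep (s : CB G C H u v) {w w' : V} (hw : Rm G C H v w) (hw' : Rm G C H v w') :
    ¬ G.Adj w w' := by
  intro hww
  obtain ⟨a, c, ⟨ha, a', ha', haa⟩, hav, hc, hcv, hac⟩ := s.X.two v
    {b | Rm G C H v b ∧ ∃ b', Rm G C H v b' ∧ G.Adj b b'}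
    ⟨w, ⟨hw, w', hw', hww⟩, by rintro rfl; exact hw.1 s.hv⟩
    ⟨u, fun h => h.1.1 s.hu, s.huv.ne⟩
  have hcH : c ∉ H := fun h => s.noH ha.1 ha.2.1 h hac
  have hcA : ¬ Att G C v c := fun h => ha.2.2 c h hac.symm
  have : ∃ y, Att G C v y ∧ G.Adj y c := by
    by_contra hcon
    push Not at hcon
    exact hc ⟨⟨hcH, hcA, hcon⟩, a, ha, hac.symm⟩
  obtain ⟨x, hx, hxc⟩ := this
  have hcN : Nb G C H v x c := ⟨hcH, hcA, hxc⟩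
  have h1 := s.noH hcH hcA s.hv
  have h2 := s.noH ha.1 ha.2.1 s.hv
  have h3 := s.noH ha'.1 ha'.2.1 s.hv
  have h4 := ha.2.2 x hx
  have h5 := ha'.2.2 x hx
  have h6 := hx.2
  have hca : G.Adj c a' := by
    by_contra h
    exact s.X.p5x v x c a a'
  obtain ⟨p, z, hp, hz, hpz⟩ := s.nbr2 hx
  have i1 := s.Rcomp ha hx hx hcN hac hp
  have i2 := s.Rcomp ha hx hx hcN hac hz
  have i3 := s.Rcomp ha' hx hx hcN hca.symm hp
  have i4 := s.Rcomp ha' hx hx hcN hca.symm hz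
  exact s.indep hx hp hz (s.X.k4x a a' p z)

theorem Rall (s : CB G C H u v) {w y m : V} (hw : Rm G C H v w) (hy : Att G C v y)
    (hm : Nb G C H v y m) : G.Adj w m := by
  have hwv : w ≠ v := by rintro rfl; exact hw.1 s.hv
  obtain ⟨a, c, ha, hav, hc, hcv, hac⟩ := s.X.two v {w} ⟨w, rfl, hwv⟩
    ⟨u, by rintro rfl; exact hw.1 s.hu, s.huv.ne⟩
  have ha' : a = w := ha
  subst ha'
  have hcH : c ∉ H := fun h => s.noH hw.1 hw.2.1 h hac
  have hcA : ¬ Att G C v c := fun h => hw.2.2 c h hac.symm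
  have : ∃ y, Att G C v y ∧ G.Adj y c := by
    by_contra hcon
    push Not at hcon
    exact s.Rindep hw ⟨hcH, hcA, hcon⟩ hac
  obtain ⟨x, hx, hxc⟩ := this
  exact s.Rcomp hw hx hy ⟨hcH, hcA, hxc⟩ hac hm

/-- The second successor of an attached vertex. -/
theorem second (s : CB G C H u v) {x p c z : V} {T : Finset V} (hx : Att G C v x)
    (hxp : G.Adj x p) (hpc : G.Adj p c) (hT : HP G c z T) (hzx : G.Adj z x) (hxT : x ∉ T)
    (hpT : p ∉ T) (hC : ∀ t, t ∈ C ↔ t = x ∨ t = p ∨ t ∈ T) (hp : Nb G C H v x p)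
    (hz : Nb G C H v x z) : ∃ y, Att G C v y ∧ y ≠ x ∧ Nb G C H v y c := by
  have hcT := hT.left_mem
  have hcC : c ∈ C := (hC c).2 (by tauto)
  have hxu := s.full hx s.hu
  have hxv := hx.2
  have hxC := hx.1
  have huv := s.huv
  have huC := s.X.hout u s.hu
  have hvC := s.X.hout v s.hv
  have hpx := hxp.ne
  have hne := huv.ne
  have hcA : ¬ Att G C v c := by
    intro h
    have := ((HP.single x).append (HP.single u) hxu (by grind)).append (HP.single v) huv (by grind)
    have := this.append hT h.2.symm (by grind)
    exact s.X.cyc2 (d := p) this hzx (by grind) (u := u) (by grind) huC (v := v) (by grind) hvC huv.ne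
  have hcH : c ∉ H := fun h => s.X.hout c h hcC
  have hxc : ¬ G.Adj x c := fun h => s.indep hx hp ⟨hcH, hcA, h⟩ hpc
  by_contra hcon
  have hR : Rm G C H v c := by
    refine ⟨hcH, hcA, ?_⟩
    intro y hy hyc
    exact hcon ⟨y, hy, by rintro rfl; exact hxc hyc, hcH, hcA, hyc⟩
  obtain ⟨y, hy, hyx⟩ := s.other hx.1
  have hyp : y ≠ p := by rintro rfl; exact hp.2.1 hy
  have hyz : y ≠ z := by rintro rfl; exact hz.2.1 hy
  have hyT : y ∈ T := by have := hy.1; grind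
  have hyv := hy.2
  obtain ⟨b, T1, T2, hT1, hyb, hT2, hd, hTT⟩ := hT.split y hyT hyz
  have hbT2 := hT2.left_mem
  have hbC : b ∈ C := (hC b).2 (by grind)
  have hbN : Nb G C H v y b := by
    refine ⟨fun h => s.X.hout b h hbC, fun hA => ?_, hyb⟩
    have := (((hT2.append (HP.single x) hzx (by grind)).append (HP.single p) hxp (by grind)).append
      hT1 hpc (by grind)).append (HP.single v) hyv (by grind)
    exact s.X.cyc1 this hA.2.symm (by grind) (u := v) (by grind) hvC
  have hcb := s.Rall hR hy hbN
  have := ((HP.single x).append (HP.single u) hxu (by grind)).append (HP.single v) huv (by grind)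
  have := (this.append hT1.symm hyv.symm (by grind)).append hT2 hcb (by grind)
  exact s.X.cyc2 (d := p) this hzx (by grind) (u := u) (by grind) huC (v := v) (by grind) hvC huv.ne

theorem onlytwo (s : CB G C H u v) {x y w n m : V} (hx : Att G C v x) (hy : Att G C v y)
    (hw : Att G C v w) (hxy : x ≠ y) (hn : Nb G C H v x n) (hm : Nb G C H v y m)
    (hnm : G.Adj n m) : w = x ∨ w = y := by
  by_contra hcon
  push Not at hcon
  obtain ⟨hwx, hwy⟩ := hcon
  have key : ∀ k, Nb G C H v w k → G.Adj k n ∧ G.Adj k m := by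
    intro k hk
    have a1 := hx.2
    have a2 := hy.2
    have b1 := hn.2.2
    have b2 := hm.2.2
    have b3 := hk.2.2
    have c1 := s.cliq hw hx hwx
    have d1 := s.uniq hx hy hxy hn
    have d2 := s.uniq hx hw hwx.symm hn
    have d3 := s.uniq hy hx hxy.symm hm
    have d4 := s.uniq hy hw hwy.symm hm
    have d5 := s.uniq hw hx hwx hk
    have d6 := s.uniq hw hy hwy hk
    have e1 := s.noH hn.1 hn.2.1 s.hv
    have e2 := s.noH hm.1 hm.2.1 s.hv
    have e3 := s.noH hk.1 hk.2.1 s.hv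
    by_cases h1 : G.Adj k n <;> by_cases h2 : G.Adj k m
    · exact ⟨h1, h2⟩
    · exact (s.X.p5x v y m n k).elim
    · exact (s.X.p5x v x n m k).elim
    · exact (s.X.p5x k w x n m).elim
  obtain ⟨p, z, hp, hz, hpz⟩ := s.nbr2 hw
  obtain ⟨k1, k2⟩ := key p hp
  obtain ⟨k3, k4⟩ := key z hz
  exact s.indep hw hp hz (s.X.k4x n m p z)

end CB

/-- Alternating paths starting in `N1` and ending in `N2`. -/
inductive AP (G : SimpleGraph V) (N1 N2 : V → Prop) : V → V → Finset V → Prop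
  | base {a b : V} : N1 a → N2 b → G.Adj a b → AP G N1 N2 a b {a, b}
  | cons {a b c d : V} {S : Finset V} : N1 a → N2 b → G.Adj a b → G.Adj b c → AP G N1 N2 c d S →
      a ∉ S → b ∉ S → AP G N1 N2 a d (insert a (insert b S))

namespace AP
variable {G : SimpleGraph V} {N1 N2 : V → Prop}

theorem congr' {a b : V} {S T : Finset V} (h : AP G N1 N2 a b S) (e : ∀ t, t ∈ S ↔ t ∈ T) :
    AP G N1 N2 a b T := by
  have : S = T := Finset.ext e
  exact this ▸ h

theorem toHP {a b : V} {S : Finset V} (h : AP G N1 N2 a b S) : HP G a b S ∧ N1 a ∧ N2 b := by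
  induction h with
  | @base a b ha hb hab =>
    exact ⟨HP.cons hab (HP.single b) (by simpa using hab.ne), ha, hb⟩
  | @cons a b c d S ha hb hab hbc _ haS hbS ih =>
    refine ⟨HP.cons hab (HP.cons hbc ih.1 hbS) ?_, ha, ih.2.2⟩
    have := hab.ne
    grind

theorem ofHP (i1 : ∀ a b, N1 a → N1 b → ¬ G.Adj a b) (i2 : ∀ a b, N2 a → N2 b → ¬ G.Adj a b)
    (k : ℕ) : ∀ (a b : V) (S : Finset V), S.card ≤ k → HP G a b S → (∀ t ∈ S, N1 t ∨ N2 t) →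
    N1 a → N2 b → ¬ N2 a → AP G N1 N2 a b S := by
  induction k with
  | zero =>
    intro a b S hk hS
    have := Finset.card_pos.2 ⟨_, hS.left_mem⟩
    omega
  | succ k ih =>
    intro a b S hk hS hN ha hb hna
    have haS := hS.left_mem
    rcases hS.inv with ⟨rfl, _⟩ | ⟨c, T, hac, hT, haT, hST⟩
    · exact absurd hb hna
    have hcT := hT.left_mem
    have hc : N2 c := (hN c ((hST c).2 (Or.inr hcT))).resolve_left (fun h => i1 a c ha h hac)
    rcases hT.inv with ⟨rfl, hT'⟩ | ⟨d, T1, hcd, hT1, hcT1, hTT1⟩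
    · exact (AP.base ha hc hac).congr' (by clear ih; grind)
    have hdT1 := hT1.left_mem
    have hd2 : ¬ N2 d := fun h => i2 c d hc h hcd
    have hd : N1 d := (hN d ((hST d).2 (Or.inr ((hTT1 d).2 (Or.inr hdT1))))).resolve_right hd2
    have hlt : T1.card < S.card := by
      have : T1 ⊂ S := ⟨by intro t; clear ih; grind, by intro h; have := h haS; clear ih; grind⟩
      exact Finset.card_lt_card this
    have := ih d b T1 (by omega) hT1 (by clear ih; grind) hd hb hd2
    exact (AP.cons ha hc hac hcd this (by clear ih; grind) hcT1).congr' (by clear ih; grind)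

theorem ins (tot : ∀ a b p q, N1 a → N2 b → N1 p → N2 q → G.Adj a b → G.Adj p q →
    G.Adj q a ∨ G.Adj b p) {a b p q : V} {S : Finset V} (h : AP G N1 N2 a b S) (hp : N1 p) (hq : N2 q)
    (hpq : G.Adj p q) (hpS : p ∉ S) (hqS : q ∉ S) :
    ∃ c d, (c = a ∨ c = p) ∧ AP G N1 N2 c d (insert p (insert q S)) := by
  induction h with
  | @base a b ha hb hab =>
    rcases tot a b p q ha hb hp hq hab hpq with h1 | h1
    · exact ⟨p, b, Or.inr rfl, AP.cons hp hq hpq h1 (AP.base ha hb hab) hpS hqS⟩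
    · refine ⟨a, q, Or.inl rfl, (AP.cons ha hb hab h1 (AP.base hp hq hpq) ?_ ?_).congr' ?_⟩
      all_goals (clear tot; grind)
  | @cons a b c d S ha hb hab hbc hS haS hbS ih =>
    rcases tot a b p q ha hb hp hq hab hpq with h1 | h1
    · exact ⟨p, d, Or.inr rfl, AP.cons hp hq hpq h1 (AP.cons ha hb hab hbc hS haS hbS) hpS hqS⟩
    · obtain ⟨c', d', hc', hAP⟩ := ih (by clear tot ih; grind) (by clear tot ih; grind)
      clear ih
      have hbc' : G.Adj b c' := by
        rcases hc' with rfl | rfl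
        · exact hbc
        · exact h1
      refine ⟨a, d', Or.inl rfl, (AP.cons ha hb hab hbc' hAP ?_ ?_).congr' ?_⟩
      all_goals (clear tot; grind)

theorem merge (tot : ∀ a b p q, N1 a → N2 b → N1 p → N2 q → G.Adj a b → G.Adj p q →
    G.Adj q a ∨ G.Adj b p) {a b p q : V} {S T : Finset V} (h : AP G N1 N2 a b S)
    (h' : AP G N1 N2 p q T) : (∀ t ∈ S, t ∉ T) → ∃ c d, AP G N1 N2 c d (S ∪ T) := by
  induction h' with
  | @base p q hp hq hpq =>
    intro hd
    obtain ⟨c, d, _, h1⟩ := h.ins tot hp hq hpq (by clear tot; grind) (by clear tot; grind)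
    exact ⟨c, d, h1.congr' (by clear tot; grind)⟩
  | @cons p q c d T hp hq hpq hqc hT hpT hqT ih =>
    intro hd
    obtain ⟨c, d, h1⟩ := ih (by clear tot ih; grind)
    clear ih
    have := hpq.ne
    obtain ⟨c, d, _, h1⟩ := h1.ins tot hp hq hpq (by clear tot; grind) (by clear tot; grind)
    exact ⟨c, d, h1.congr' (by clear tot; grind)⟩

end AP

namespace CB
variable {G : SimpleGraph V} {C : Finset V} {H : Set V} {u v : V}

theorem geo {x y p z : V} {S : Finset V} (hS : HP G p z S) (nx : x ∉ S)
    (hC : ∀ t, t ∈ C ↔ t = x ∨ t ∈ S) (hyS : y ∈ S) (hyz : y ≠ z) (hyp : y ≠ p) :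
    ∃ a b S0 S2, HP G a p S0 ∧ HP G b z S2 ∧ G.Adj y a ∧ G.Adj y b ∧ x ∉ S0 ∧ x ∉ S2 ∧ y ∉ S0 ∧
      y ∉ S2 ∧ (∀ t ∈ S0, t ∉ S2) ∧ ∀ t, t ∈ C ↔ t = x ∨ t = y ∨ t ∈ S0 ∨ t ∈ S2 := by
  obtain ⟨b, S1, S2, hS1, hyb, hS2, hd, hSS⟩ := hS.split y hyS hyz
  rcases hS1.symm.inv with ⟨e, _⟩ | ⟨a, S0, hya, hS0, hyS0, hSS0⟩
  · exact absurd e hyp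
  refine ⟨a, b, S0, S2, hS0, hS2, hya, hyb, ?_, ?_, hyS0, ?_, ?_, ?_⟩
  all_goals grind

theorem close (s : CB G C H u v) {x y c d : V} {S : Finset V} (hx : Att G C v x) (hy : Att G C v y)
    (hxy : x ≠ y) (q4 : HP G c d S) (hdy : G.Adj d y) (hxc : G.Adj x c) (nx : x ∉ S) (ny : y ∉ S)
    (hC : ∀ t, t ∈ C ↔ t = x ∨ t = y ∨ t ∈ S) : False := by
  have huC := s.X.hout u s.hu
  have hvC := s.X.hout v s.hv
  have hyu := s.full hy s.hu
  have hxv := hx.2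
  have hxC := hx.1
  have hyC := hy.1
  have huv := s.huv
  have hne := huv.ne
  have := (((q4.append (HP.single y) hdy (by grind)).append (HP.single u) hyu (by grind)).append
    (HP.single v) huv (by grind)).append (HP.single x) hxv.symm (by grind)
  exact s.X.cyc1 this hxc (by grind) (u := u) (by grind) huC

theorem sides (s : CB G C H u v) {x y a b p z : V} {S0 S2 : Finset V} (hy : Att G C v y)
    (hS0 : HP G a p S0) (hS2 : HP G b z S2) (hya : G.Adj y a) (hyb : G.Adj y b) (xS0 : x ∉ S0)
    (xS2 : x ∉ S2) (yS0 : y ∉ S0) (yS2 : y ∉ S2) (hd : ∀ t ∈ S0, t ∉ S2) (hxy : x ≠ y)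
    (hC : ∀ t, t ∈ C ↔ t = x ∨ t = y ∨ t ∈ S0 ∨ t ∈ S2) (hxp : G.Adj x p) (hzx : G.Adj z x) :
    Nb G C H v y b := by
  have := (hS2.append (HP.single x) hzx (by grind)).append hS0.symm hxp (by grind)
  exact s.succN hy this (by grind) (by grind) hyb hya.symm

theorem final (s : CB G C H u v) : False := by
  obtain ⟨x, hx⟩ := s.exA
  obtain ⟨p, z, S, hS, nx, hC, hxp, hzx, hpz⟩ := s.X.rot x hx.1
  have hp := s.succN hx hS nx hC hxp hzx
  have hz := s.succN hx hS.symm nx hC hzx.symm hxp.symm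
  rcases hS.inv with ⟨e, _⟩ | ⟨c, T, hpc, hT, hpT, hST⟩
  · exact hpz e
  rcases hS.symm.inv with ⟨e, _⟩ | ⟨c', T', hzc', hT', hzT', hST'⟩
  · exact hpz e.symm
  obtain ⟨y, hy, hyx, hyc⟩ := s.second hx hxp hpc hT hzx (by grind) hpT (by grind) hp hz
  obtain ⟨y', hy', hyx', hyc'⟩ := s.second hx hzx.symm hzc' hT' hxp.symm (by grind) hzT' (by grind) hz hp
  have hA : ∀ w, Att G C v w → w = x ∨ w = y := fun w hw => s.onlytwo hx hy hw hyx.symm hp hyc hpc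
  have e : y' = y := (hA y' hy').resolve_left hyx'
  subst e
  have hR : ∀ w, ¬ Rm G C H v w := by
    intro w hw
    have h1 := s.indep hx hp hz
    have h2 := s.indep hy hyc hyc'
    have h3 := s.uniq hy hx hyx hyc
    have h4 := s.uniq hy hx hyx hyc'
    have h5 := s.Rall hw hx hp
    have h6 := s.Rall hw hx hz
    have h7 := s.Rall hw hy hyc
    have h8 := s.Rall hw hy hyc'
    by_cases h9 : G.Adj p c'
    · exact h1 (s.X.k4x w c' p z)
    · by_cases h10 : G.Adj z c
      · exact h1 (s.X.k4x w c p z)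
      · exact s.X.p5x c p x z c'
  have hN : ∀ t ∈ C, t ≠ x → t ≠ y' → Nb G C H v x t ∨ Nb G C H v y' t := by
    intro t ht htx hty
    have t1 : t ∉ H := fun h => s.X.hout t h ht
    have t2 : ¬ Att G C v t := fun h => by rcases hA t h with h | h <;> contradiction
    by_contra hcon
    push Not at hcon
    refine hR t ⟨t1, t2, ?_⟩
    intro w hw hwt
    rcases hA w hw with rfl | rfl
    · exact hcon.1 ⟨t1, t2, hwt⟩
    · exact hcon.2 ⟨t1, t2, hwt⟩
  have i1 : ∀ a b, Nb G C H v x a → Nb G C H v x b → ¬ G.Adj a b := fun a b ha hb => s.indep hx ha hb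
  have i2 : ∀ a b, Nb G C H v y' a → Nb G C H v y' b → ¬ G.Adj a b := fun a b ha hb => s.indep hy ha hb
  have disj : ∀ a, Nb G C H v x a → ¬ Nb G C H v y' a := fun a ha hb =>
    s.uniq hx hy hyx.symm ha hb.2.2
  have tot : ∀ a b p q, Nb G C H v x a → Nb G C H v y' b → Nb G C H v x p → Nb G C H v y' q →
      G.Adj a b → G.Adj p q → G.Adj q a ∨ G.Adj b p := by
    intro a b p q ha hb hp hq hab hpq
    by_contra hcon
    push Not at hcon
    obtain ⟨n1, n2⟩ := hcon
    have g1 := i1 a p ha hp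
    have g2 := i2 b q hb hq
    have g3 := s.uniq hy hx hyx hb
    have g4 := s.uniq hy hx hyx hq
    have g5 := ha.2.2
    have g6 := hp.2.2
    exact s.X.p5x b a x p q
  have huC := s.X.hout u s.hu
  have hvC := s.X.hout v s.hv
  have hyC := hy.1
  have hxC := hx.1
  have hyS : y' ∈ S := ((hC y').1 hyC).resolve_left hyx
  have hyz : y' ≠ z := by rintro rfl; exact hz.2.1 hy
  have hyp : y' ≠ p := by rintro rfl; exact hp.2.1 hy
  have hyv := hy.2
  have hxv := hx.2
  have hyu := s.full hy s.hu
  have hxu := s.full hx s.hu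
  have huv := s.huv
  have hne := huv.ne
  obtain ⟨a, b, S0, S2, hS0, hS2, hya, hyb, xS0, xS2, yS0, yS2, hd, hC2⟩ :=
    geo hS nx hC hyS hyz hyp
  have hb : Nb G C H v y' b := s.sides hy hS0 hS2 hya hyb xS0 xS2 yS0 yS2 hd hyx.symm hC2 hxp hzx
  have ha : Nb G C H v y' a := s.sides hy hS2 hS0 hyb hya xS2 xS0 yS2 yS0
    (fun t h1 h2 => hd t h2 h1) hyx.symm (fun t => by rw [hC2]; tauto) hzx.symm hxp.symm
  have q1 := AP.ofHP i1 i2 _ p a S0 le_rfl hS0.symm (fun t ht => hN t ((hC2 t).2 (by tauto))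
    (fun e => xS0 (e ▸ ht)) (fun e => yS0 (e ▸ ht))) hp ha (disj p hp)
  have q2 := AP.ofHP i1 i2 _ z b S2 le_rfl hS2.symm (fun t ht => hN t ((hC2 t).2 (by tauto))
    (fun e => xS2 (e ▸ ht)) (fun e => yS2 (e ▸ ht))) hz hb (disj z hz)
  obtain ⟨c, d, q3⟩ := q1.merge tot q2 hd
  obtain ⟨q4, q5, q6⟩ := q3.toHP
  refine s.close hx hy hyx.symm q4 q6.2.2.symm q5.2.2 ?_ ?_ ?_
  · simp [xS0, xS2]
  · simp [yS0, yS2]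
  · intro t
    rw [hC2, Finset.mem_union]

end CB

theorem Ctx.done {G : SimpleGraph V} {C : Finset V} {H : Set V} (X : Ctx G C H) {u v : V}
    (hu : u ∈ H) (hv : v ∈ H) (huv : G.Adj u v) : False := by
  refine CB.final (G := G) (C := C) (H := H) (u := u) (v := v) ⟨X, hu, hv, huv, ?_⟩
  intro x hx g hg hxg
  exact X.hind (fun h => G.Adj x h) g hg hxg (fun a ha b hb hab hxa => X.caseA ha hb hab hx hxa)

theorem HP.toFun {G : SimpleGraph V} {a b : V} {S : Finset V} (h : HP G a b S) :
    ∃ f : ℕ → V, f 0 = a ∧ f (S.card - 1) = b ∧ (∀ i < S.card, f i ∈ S) ∧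
      (∀ i j, i < S.card → j < S.card → f i = f j → i = j) ∧
      ∀ i, i + 1 < S.card → G.Adj (f i) (f (i + 1)) := by
  induction h with
  | single a =>
    refine ⟨fun _ => a, rfl, rfl, by simp, ?_, ?_⟩
    · intro i j hi hj _
      simp at hi hj
      omega
    · intro i hi
      simp at hi
  | @cons a b c S hab hS hn ih =>
    obtain ⟨f, f0, f1, fm, fi, fa⟩ := ih
    have hpos : 0 < S.card := Finset.card_pos.2 ⟨b, hS.left_mem⟩
    rw [Finset.card_insert_of_notMem hn]
    refine ⟨fun i => Nat.casesOn i a f, rfl, ?_, ?_, ?_, ?_⟩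
    · obtain ⟨k, hk⟩ : ∃ k, S.card = k + 1 := ⟨S.card - 1, by omega⟩
      rw [hk] at f1 ⊢
      exact f1
    · intro i hi
      rcases i with _ | i
      · simp
      · simp only [Finset.mem_insert]
        exact Or.inr (fm i (by omega))
    · intro i j hi hj hij
      rcases i with _ | i <;> rcases j with _ | j
      · rfl
      · exact absurd (fm j (by omega)) (by simp only at hij; rwa [← hij])
      · exact absurd (fm i (by omega)) (by simp only at hij; rwa [hij])
      · rw [fi i j (by omega) (by omega) hij]
    · intro i hi
      rcases i with _ | i
      · simpa [f0] using hab
      · exact fa i (by omega)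

theorem HP.toCycle {G : SimpleGraph V} {a b : V} {S : Finset V} (h : HP G a b S) (hba : G.Adj b a)
    (h3 : 3 ≤ S.card) : ∃ c : ZMod S.card → V, IsCycleOn G S.card c := by
  obtain ⟨f, f0, f1, fm, fi, fa⟩ := h.toFun
  haveI : NeZero S.card := ⟨by omega⟩
  haveI : Fact (1 < S.card) := ⟨by omega⟩
  refine ⟨fun i => f i.val, h3, ?_, ?_⟩
  · intro i j hij
    exact ZMod.val_injective _ (fi _ _ (ZMod.val_lt i) (ZMod.val_lt j) hij)
  · intro i
    show G.Adj (f i.val) (f (i + 1).val)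
    have hi := ZMod.val_lt i
    have e : (i + 1).val = (i.val + 1) % S.card := by rw [ZMod.val_add, ZMod.val_one]
    by_cases hlt : i.val + 1 < S.card
    · rw [e, Nat.mod_eq_of_lt hlt]
      exact fa _ hlt
    · have h1 : i.val + 1 = S.card := by omega
      have h2 : i.val = S.card - 1 := by omega
      rw [e, h1, Nat.mod_self, f0, h2, f1]
      exact hba

theorem cycleHP {G : SimpleGraph V} {n : ℕ} {c : ZMod n → V} (hc : IsCycleOn G n c) (i : ZMod n)
    (k : ℕ) : k + 1 < n → HP G (c (i + 1)) (c (i + 1 + (k : ZMod n)))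
      ((Finset.range (k + 1)).image (fun j : ℕ => c (i + 1 + (j : ZMod n)))) := by
  obtain ⟨h3, hinj, hadj⟩ := hc
  have hne : ∀ j j' : ℕ, j < n → j' < n → c (i + 1 + (j : ZMod n)) = c (i + 1 + (j' : ZMod n)) →
      j = j' := by
    intro j j' hj hj' h
    have := add_left_cancel (hinj h)
    rw [ZMod.natCast_eq_natCast_iff', Nat.mod_eq_of_lt hj, Nat.mod_eq_of_lt hj'] at this
    exact this
  induction k with
  | zero =>
    intro _
    simpa using HP.single (G := G) (c (i + 1))
  | succ k ih =>
    intro hk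
    have h1 := ih (by omega)
    have h2 := hadj (i + 1 + (k : ZMod n))
    rw [add_assoc (i + 1)] at h2
    have e : ((k : ZMod n) + 1) = ((k + 1 : ℕ) : ZMod n) := by push_cast; rfl
    rw [e] at h2
    refine (h1.append (HP.single _) h2 ?_).congr' ?_
    · intro t ht
      simp only [Finset.mem_image, Finset.mem_range] at ht
      obtain ⟨j, hj, rfl⟩ := ht
      simp only [Finset.mem_singleton]
      intro h
      have := hne j (k + 1) (by omega) (by omega) h
      omega
    · intro t
      rw [Finset.range_add_one (n := k + 1), Finset.image_insert]
      simp only [Finset.mem_union, Finset.mem_singleton, Finset.mem_insert]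
      tauto

theorem cycleRot {G : SimpleGraph V} {n : ℕ} {c : ZMod n → V} (hc : IsCycleOn G n c)
    (C : Finset V) (hC : ∀ t, t ∈ C ↔ t ∈ Set.range c) : ∀ x ∈ C, ∃ p z S, HP G p z S ∧ x ∉ S ∧
    (∀ t, t ∈ C ↔ t = x ∨ t ∈ S) ∧ G.Adj x p ∧ G.Adj z x ∧ p ≠ z := by
  intro x hx
  obtain ⟨i, rfl⟩ := (hC x).1 hx
  obtain ⟨h3, hinj, hadj⟩ := id hc
  haveI : NeZero n := ⟨by omega⟩
  have key : ∀ j : ℕ, i + 1 + (j : ZMod n) = i + ((j + 1 : ℕ) : ZMod n) := by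
    intro j; push_cast; ring
  have hP := cycleHP hc i (n - 2) (by omega)
  have e1 : n - 2 + 1 = n - 1 := by omega
  refine ⟨_, _, _, hP, ?_, ?_, hadj i, ?_, ?_⟩
  · intro h
    simp only [Finset.mem_image, Finset.mem_range] at h
    obtain ⟨j, hj, h⟩ := h
    have := hinj h
    rw [key] at this
    have h0 : ((j + 1 : ℕ) : ZMod n) = 0 := by
      have h' : i + ((j + 1 : ℕ) : ZMod n) = i + 0 := by rw [this, add_zero]
      exact add_left_cancel h'
    rw [ZMod.natCast_eq_zero_iff] at h0
    have := Nat.le_of_dvd (by omega) h0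
    omega
  · intro t
    rw [hC]
    simp only [Finset.mem_image, Finset.mem_range]
    constructor
    · rintro ⟨j, rfl⟩
      by_cases hj : j = i
      · left; rw [hj]
      · right
        have hne : (j - i) ≠ 0 := sub_ne_zero.2 hj
        have hv : (j - i).val ≠ 0 := by rwa [Ne, ZMod.val_eq_zero]
        have hlt := ZMod.val_lt (j - i)
        refine ⟨(j - i).val - 1, by omega, ?_⟩
        rw [key, show (j - i).val - 1 + 1 = (j - i).val by omega, ZMod.natCast_zmod_val]
        congr 1; ring
    · rintro (rfl | ⟨j, _, rfl⟩)
      · exact ⟨_, rfl⟩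
      · exact ⟨_, rfl⟩
  · have := hadj (i + 1 + ((n - 2 : ℕ) : ZMod n))
    have e : i + 1 + ((n - 2 : ℕ) : ZMod n) + 1 = i := by
      rw [key, e1, add_assoc]
      have : ((n - 1 : ℕ) : ZMod n) + 1 = ((n - 1 + 1 : ℕ) : ZMod n) := by push_cast; rfl
      rw [this, show n - 1 + 1 = n by omega, ZMod.natCast_self, add_zero]
    rwa [e] at this
  · intro h
    have h1 : i + 1 + 0 = i + 1 + ((n - 2 : ℕ) : ZMod n) := by rw [add_zero]; exact hinj h
    have := add_left_cancel h1
    have := this.symm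
    rw [ZMod.natCast_eq_zero_iff] at this
    have := Nat.le_of_dvd (by omega) this
    omega

theorem twoLemma {G : SimpleGraph V} (h2 : TwoConnected G) (d : V) (X : Set V)
    (ha : ∃ a ∈ X, a ≠ d) (hb : ∃ b, b ∉ X ∧ b ≠ d) :
    ∃ a b, a ∈ X ∧ a ≠ d ∧ b ∉ X ∧ b ≠ d ∧ G.Adj a b := by
  obtain ⟨a, haX, had⟩ := ha
  obtain ⟨b, hbX, hbd⟩ := hb
  obtain ⟨w⟩ := (h2.2.2 d).preconnected ⟨a, had⟩ ⟨b, hbd⟩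
  obtain ⟨e, _, h1, h3⟩ := w.exists_boundary_dart {t | (t : V) ∈ X} haX hbX
  exact ⟨e.fst, e.snd, h1, e.fst.2, h3, e.snd.2, e.adj⟩

theorem reachHP {G : SimpleGraph V} {C : Finset V} {g h : V} (hg : g ∉ C)
    (hr : Relation.ReflTransGen (fun a b => G.Adj a b ∧ a ∉ C ∧ b ∉ C) g h) :
    ∃ W, HP G g h W ∧ ∀ t ∈ W, t ∉ C := by
  induction hr with
  | refl => exact ⟨{g}, HP.single g, by simpa using hg⟩
  | @tail b c _ hbc ih =>
    obtain ⟨W, hW, hWC⟩ := ih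
    obtain ⟨h1, h2, h3⟩ := hbc
    by_cases hc : c ∈ W
    · obtain ⟨w, S1, S2, q1, _, _, _, q5⟩ := hW.split c hc h1.symm.ne
      exact ⟨S1, q1, fun t ht => hWC t ((q5 t).2 (Or.inl ht))⟩
    · refine ⟨W ∪ {c}, hW.append (HP.single c) h1 ?_, ?_⟩
      · intro t ht; simp only [Finset.mem_singleton]; rintro rfl; exact hc ht
      · intro t ht
        simp only [Finset.mem_union, Finset.mem_singleton] at ht
        rcases ht with ht | rfl
        · exact hWC t ht
        · exact h3

theorem existsCycle {G : SimpleGraph V} (h2 : TwoConnected G) :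
    ∃ (n : ℕ) (c : ZMod n → V), IsCycleOn G n c := by
  obtain ⟨v, w, t, hvw, hvt, hwt⟩ := Fintype.two_lt_card_iff.1 h2.1
  obtain ⟨v1, a, hv1, _, hav, haw, hva⟩ := twoLemma h2 w {v} ⟨v, rfl, hvw⟩ ⟨t, hvt.symm, hwt.symm⟩
  have e : v1 = v := hv1
  subst e
  obtain ⟨v2, b, hv2, _, hbv, hba, hvb⟩ := twoLemma h2 a {v1} ⟨v1, rfl, hva.ne⟩ ⟨w, hvw.symm, haw.symm⟩
  have e : v2 = v1 := hv2
  subst e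
  have hr : Relation.ReflTransGen (fun a b => G.Adj a b ∧ a ∉ ({v2} : Finset V) ∧ b ∉ ({v2} : Finset V)) a b := by
    by_contra hcon
    obtain ⟨a', b', h1, h3, h4, h5, h6⟩ := twoLemma h2 v2
      {t | Relation.ReflTransGen (fun a b => G.Adj a b ∧ a ∉ ({v2} : Finset V) ∧ b ∉ ({v2} : Finset V)) a t}
      ⟨a, Relation.ReflTransGen.refl, hva.symm.ne⟩ ⟨b, hcon, hvb.symm.ne⟩
    exact h4 (Relation.ReflTransGen.tail h1 ⟨h6, by simpa using h3, by simpa using h5⟩)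
  obtain ⟨W, hW, hWC⟩ := reachHP (by simpa using hva.symm.ne) hr
  have hP := (HP.single v2).append hW hva (by
    intro t ht h
    exact hWC t h ht)
  have hsub : ({v2, a, b} : Finset V) ⊆ {v2} ∪ W := by
    have := hW.left_mem
    have := hW.right_mem
    intro t ht
    simp only [Finset.mem_insert, Finset.mem_singleton] at ht
    simp only [Finset.mem_union, Finset.mem_singleton]
    rcases ht with rfl | rfl | rfl <;> tauto
  have hcard : ({v2, a, b} : Finset V).card = 3 :=
    Finset.card_eq_three.2 ⟨v2, a, b, hva.ne, hvb.ne, hba.symm, rfl⟩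
  obtain ⟨c, hc⟩ := hP.toCycle hvb.symm (hcard ▸ Finset.card_le_card hsub)
  exact ⟨_, c, hc⟩

theorem cycleBound {G : SimpleGraph V} {n : ℕ} {c : ZMod n → V} (hc : IsCycleOn G n c) :
    n ≤ Fintype.card V := by
  haveI : NeZero n := ⟨by have := hc.1; omega⟩
  have := Fintype.card_le_of_injective c hc.2.1
  rwa [ZMod.card] at this

theorem p5Lemma {G : SimpleGraph V} (hp : P5Free G) : ∀ a b c d e : V, G.Adj a b → G.Adj b c →
    G.Adj c d → G.Adj d e →
    G.Adj a c ∨ G.Adj a d ∨ G.Adj a e ∨ G.Adj b d ∨ G.Adj b e ∨ G.Adj c e := by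
  intro a b c d e hab hbc hcd hde
  by_contra hcon
  push Not at hcon
  obtain ⟨n1, n2, n3, n4, n5, n6⟩ := hcon
  have hac : a ≠ c := by rintro rfl; exact n2 hcd
  have had : a ≠ d := by rintro rfl; exact n3 hde
  have hae : a ≠ e := by rintro rfl; exact n2 hde.symm
  have hbd : b ≠ d := by rintro rfl; exact n2 hab
  have hbe : b ≠ e := by rintro rfl; exact n3 hab
  have hce : c ≠ e := by rintro rfl; exact n5 hbc
  have hinj : ∀ i j : ℕ, i < j → j < 5 →
      (match i with | 0 => a | 1 => b | 2 => c | 3 => d | _ => e) ≠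
      (match j with | 0 => a | 1 => b | 2 => c | 3 => d | _ => e) := by
    intro i j hi hj
    interval_cases j <;> interval_cases i
    exacts [hab.ne, hac, hbc.ne, had, hbd, hcd.ne, hae, hbe, hce, hde.ne]
  have hind : ∀ i j : ℕ, i + 1 < j → j < 5 →
      ¬ G.Adj (match i with | 0 => a | 1 => b | 2 => c | 3 => d | _ => e)
      (match j with | 0 => a | 1 => b | 2 => c | 3 => d | _ => e) := by
    intro i j hi hj
    have hi' : i < 3 := by omega
    interval_cases j
    · omega
    · omega
    · obtain rfl : i = 0 := by omega
      exact n1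
    · obtain rfl | rfl : i = 0 ∨ i = 1 := by omega
      exacts [n2, n4]
    · obtain rfl | rfl | rfl : i = 0 ∨ i = 1 ∨ i = 2 := by omega
      exacts [n3, n5, n6]
  refine hp ⟨fun i => match i with | 0 => a | 1 => b | 2 => c | 3 => d | _ => e, ⟨?_, ?_⟩, ?_⟩
  · intro i j hi hj hij
    rcases lt_trichotomy i j with h | h | h
    · exact absurd hij (hinj i j h hj)
    · exact h
    · exact absurd hij.symm (hinj j i h hi)
  · intro i hi
    have : i < 4 := by omega
    interval_cases i <;> assumption
  · intro i j hi hj hij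
    by_contra hc
    rcases lt_trichotomy i j with h | h | h
    · exact hind i j (by omega) hj hij
    · subst h
      exact hij.ne rfl
    · exact hind j i (by omega) hi hij.symm

theorem stmt_9 (G : SimpleGraph V) (h2 : TwoConnected G)
    (hp : P5Free G) (hk : K4mFree G) :
    ∃ (n : ℕ) (c : ZMod n → V), IsLongestCycle G n c ∧ DominatingCycle G n c := by
  classical
  obtain ⟨n0, c0, hc0⟩ := existsCycle h2
  have hspec := Nat.findGreatest_spec (P := fun n => ∃ c : ZMod n → V, IsCycleOn G n c)
    (cycleBound hc0) ⟨c0, hc0⟩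
  set n := Nat.findGreatest (fun n => ∃ c : ZMod n → V, IsCycleOn G n c) (Fintype.card V) with hn
  obtain ⟨c, hc⟩ := hspec
  have hmax : ∀ (m : ℕ) (d : ZMod m → V), IsCycleOn G m d → m ≤ n := fun m d hd =>
    Nat.le_findGreatest (P := fun n => ∃ c : ZMod n → V, IsCycleOn G n c) (cycleBound hd) ⟨d, hd⟩
  refine ⟨n, c, ⟨hc, hmax⟩, hc, ?_⟩
  intro u v huv
  by_contra hcon
  push Not at hcon
  obtain ⟨hu, hv⟩ := hcon
  haveI : NeZero n := ⟨by have := hc.1; omega⟩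
  let C : Finset V := Finset.univ.image c
  have hC : ∀ t, t ∈ C ↔ t ∈ Set.range c := by intro t; simp [C]
  have hcard : C.card = n := by
    rw [Finset.card_image_of_injective _ hc.2.1, Finset.card_univ, ZMod.card]
  have huC : u ∉ C := by rwa [hC]
  have hvC : v ∉ C := by rwa [hC]
  let R : V → V → Prop := fun a b => G.Adj a b ∧ a ∉ C ∧ b ∉ C
  have hsymm : ∀ a b, Relation.ReflTransGen R a b → Relation.ReflTransGen R b a := by
    intro a b h
    induction h with
    | refl => exact Relation.ReflTransGen.refl
    | tail _ hbc ih => exact Relation.ReflTransGen.head ⟨hbc.1.symm, hbc.2.2, hbc.2.1⟩ ih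
  let H : Set V := {w | Relation.ReflTransGen R u w}
  have hout : ∀ h ∈ H, h ∉ C := by
    intro h hh
    rcases Relation.ReflTransGen.cases_tail hh with rfl | ⟨b, _, hb⟩
    · exact huC
    · exact hb.2.2
  have X : Ctx G C H := by
    refine ⟨?_, ?_, ?_, cycleRot hc C hC, hout, ?_, ?_, ?_, twoLemma h2⟩
    · exact p5Lemma hp
    · intro a b c d h1 h3 h4 h5 h6 hne
      by_contra hcd
      exact hk ⟨a, b, c, d, h1.ne, h3.ne, h4.ne, h5.ne, h6.ne, hne, h1, h3, h4, h5, h6, hcd⟩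
    · intro a b S hS hba hlt
      have := hc.1
      obtain ⟨d, hd⟩ := hS.toCycle hba (by omega)
      have := hmax _ d hd
      omega
    · intro h hh w hhw hwC
      exact Relation.ReflTransGen.tail hh ⟨hhw, hout h hh, hwC⟩
    · intro g hg h hh
      exact reachHP (hout g hg) ((hsymm u g hg).trans hh)
    · intro P g hg hPg hstep h hh
      have hgh : Relation.ReflTransGen R g h := (hsymm u g hg).trans hh
      have : h ∈ H ∧ P h := by
        clear hh
        induction hgh with
        | refl => exact ⟨hg, hPg⟩
        | @tail b c _ hbc ih =>
          have hcH : c ∈ H := Relation.ReflTransGen.tail ih.1 hbc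
          exact ⟨hcH, hstep b ih.1 c hcH hbc.1 ih.2⟩
      exact this.2
  exact X.done Relation.ReflTransGen.refl
    (Relation.ReflTransGen.tail Relation.ReflTransGen.refl ⟨huv, huC, hvC⟩) huv
end

section
/- Let G be a P5-free graph in which no longest cycle is dominating, let C be a longest cycle of G minimizing first μ(C) and then ω(C), and let H be a component of G − C with |H| = μ(C) ≥ 2. Let v1, v2 be distinct vertices on C each with a neighbor in H such that |N_G(v1; H) ∪ N_G(v2; H)| ≥ 2. If some vertex of H is not adjacent to v1 and v1v2⁻ is an edge of G, then v1⁻²v1⁺² is not an edge of G. -/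
open SimpleGraph

variable {V : Type*} [Fintype V] [DecidableEq V]

/-- A connected vertex set is contained in any set it meets that is closed under adjacency. -/
lemma conn_closed (G : SimpleGraph V) (K S : Set V) (hK : (G.induce K).Connected)
    (u : V) (hu : u ∈ K) (huS : u ∈ S)
    (hcl : ∀ a b, a ∈ K → b ∈ K → a ∈ S → G.Adj a b → b ∈ S) : K ⊆ S := by
  intro v hv
  obtain ⟨w⟩ := hK.preconnected ⟨u, hu⟩ ⟨v, hv⟩
  have key : ∀ (a b : K) (_ : (G.induce K).Walk a b), (a : V) ∈ S → (b : V) ∈ S := by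
    intro a b w
    induction w with
    | nil => exact id
    | cons h _ ih =>
      intro ha
      exact ih (hcl _ _ (Subtype.property _) (Subtype.property _) ha (by simpa using h))
  exact key _ _ w huS

/-- Paths inside a connected set, as lists. -/
lemma exists_list_path (G : SimpleGraph V) (K : Set V) (hK : (G.induce K).Connected)
    (x y : V) (hx : x ∈ K) (hy : y ∈ K) :
    ∃ P : List V, P.Nodup ∧ P.IsChain G.Adj ∧ P.head? = some x ∧ P.getLast? = some y ∧
      ∀ v ∈ P, v ∈ K := by
  obtain ⟨w, hw⟩ := (hK.preconnected ⟨x, hx⟩ ⟨y, hy⟩).exists_isPath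
  refine ⟨w.support.map Subtype.val, ?_, ?_, ?_, ?_, ?_⟩
  · exact hw.support_nodup.map Subtype.val_injective
  · rw [List.isChain_map]
    exact (w.isChain_adj_support).imp (fun a b h => by simpa using h)
  · rw [List.head?_map, List.head?_eq_some_head w.support_ne_nil, w.head_support]; rfl
  · rw [List.getLast?_map, List.getLast?_eq_some_getLast w.support_ne_nil, w.getLast_support]; rfl
  · intro v hv
    obtain ⟨a, _, rfl⟩ := List.mem_map.1 hv
    exact a.2

/-- A cyclic list gives a cycle. -/
lemma cycle_of_list (G : SimpleGraph V) (l : List V) (h3 : 3 ≤ l.length) (hnd : l.Nodup)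
    (hch : l.IsChain G.Adj) (hcl : ∀ a ∈ l.getLast?, ∀ b ∈ l.head?, G.Adj a b) :
    ∃ d : ZMod l.length → V, IsCycleOn G l.length d ∧ ∀ v, v ∈ Set.range d ↔ v ∈ l := by
  haveI : NeZero l.length := ⟨by omega⟩
  haveI : Fact (1 < l.length) := ⟨by omega⟩
  refine ⟨fun i => l[i.val]'(ZMod.val_lt i), ⟨h3, ?_, ?_⟩, ?_⟩
  · intro i j hij
    exact ZMod.val_injective _ ((hnd.getElem_inj_iff).1 hij)
  · intro i
    by_cases hi : i.val + 1 < l.length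
    · have : (i + 1).val = i.val + 1 := by
        rw [ZMod.val_add, ZMod.val_one, Nat.mod_eq_of_lt hi]
      simp only [this]
      exact List.isChain_iff_getElem.1 hch _ hi
    · have hlt := ZMod.val_lt i
      have hv : i.val = l.length - 1 := by omega
      have : (i + 1).val = 0 := by
        rw [ZMod.val_add, ZMod.val_one, hv, Nat.sub_add_cancel (by omega), Nat.mod_self]
      simp only [this, hv]
      apply hcl
      · rw [List.getLast?_eq_getElem?]; simp
      · rw [List.head?_eq_getElem?]; simp
  · intro v
    constructor
    · rintro ⟨i, rfl⟩
      exact List.getElem_mem _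
    · intro hv
      obtain ⟨k, hk, rfl⟩ := List.getElem_of_mem hv
      exact ⟨(k : ZMod l.length), by simp [ZMod.val_natCast, Nat.mod_eq_of_lt hk]⟩

/-- The arc `f a, ..., f (a + m - 1)`. -/
def arcL (f : ℕ → V) (a m : ℕ) : List V := (List.range' a m).map f

lemma arcL_length (f : ℕ → V) (a m : ℕ) : (arcL f a m).length = m := by simp [arcL]

lemma arcL_mem (f : ℕ → V) (a m : ℕ) (v : V) :
    v ∈ arcL f a m ↔ ∃ j, a ≤ j ∧ j < a + m ∧ f j = v := by
  simp [arcL, and_assoc]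

lemma arcL_head (f : ℕ → V) (a m : ℕ) (hm : 0 < m) : (arcL f a m).head? = some (f a) := by
  obtain ⟨m, rfl⟩ := Nat.exists_eq_succ_of_ne_zero hm.ne'
  simp [arcL, List.range'_succ]

lemma arcL_last (f : ℕ → V) (a m : ℕ) (hm : 0 < m) :
    (arcL f a m).getLast? = some (f (a + m - 1)) := by
  obtain ⟨m, rfl⟩ := Nat.exists_eq_succ_of_ne_zero hm.ne'
  simp [arcL, List.range'_concat]

lemma arcL_chain (G : SimpleGraph V) (f : ℕ → V) (hf : ∀ j, G.Adj (f j) (f (j + 1))) (a m : ℕ) :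
    (arcL f a m).IsChain G.Adj := by
  rw [List.isChain_iff_getElem]
  intro i hi
  simp only [arcL, List.getElem_map, List.getElem_range', one_mul]
  exact hf _

lemma arcL_nodup (f : ℕ → V) (a m n : ℕ) (hf : ∀ i j, i < n → j < n → f i = f j → i = j)
    (h : a + m ≤ n) : (arcL f a m).Nodup := by
  refine List.Nodup.map_on ?_ List.nodup_range'
  intro x hx y hy hxy
  simp at hx hy
  exact hf _ _ (by omega) (by omega) hxy

/-- Replacing an arc of a longest cycle by an outside path `P` cannot lengthen it. -/
lemma no_detour (G : SimpleGraph V) (n : ℕ) (c : ZMod n → V) (hc : IsLongestCycle G n c)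
    (i : ZMod n) (t : ℕ) (ht : 1 ≤ t) (htn : t < n) (P : List V) (x y : V)
    (hnd : P.Nodup) (hch : P.IsChain G.Adj) (hx : P.head? = some x) (hy : P.getLast? = some y)
    (hoff : ∀ v ∈ P, v ∉ Set.range c) (h1 : G.Adj (c i) x) (h2 : G.Adj (c (i + t)) y) :
    P.length + 1 ≤ t := by
  obtain ⟨⟨h3, hinj, hadj⟩, hmax⟩ := hc
  set f : ℕ → V := fun j => c (i + t + j) with hf
  have hfa : ∀ j, G.Adj (f j) (f (j + 1)) := by
    intro j
    have := hadj (i + t + j)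
    simpa [hf, add_assoc] using this
  have hfi : ∀ a b, a < n → b < n → f a = f b → a = b := by
    intro a b ha hb hab
    have := add_left_cancel (hinj hab)
    exact (ZMod.natCast_eq_natCast_iff' a b n).1 this |> fun h => by
      rwa [Nat.mod_eq_of_lt ha, Nat.mod_eq_of_lt hb] at h
  have hlast : f (n - t) = c i := by
    simp only [hf]
    rw [Nat.cast_sub htn.le]; simp
  have hP : 1 ≤ P.length := by
    cases P with
    | nil => simp at hx
    | cons => simp
  by_contra hcon
  have harc : 0 < n - t + 1 := by omega
  obtain ⟨d, hd, _⟩ := cycle_of_list G (P ++ (arcL f 0 (n - t + 1)))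
    (by
      have := arcL_length f 0 (n - t + 1)
      simp only [List.length_append, this]; omega)
    (by
      rw [List.nodup_append']
      refine ⟨hnd, arcL_nodup f 0 _ n hfi (by omega), ?_⟩
      intro v hv hv'
      obtain ⟨j, _, _, rfl⟩ := (arcL_mem _ _ _ _).1 hv'
      exact hoff _ hv ⟨_, rfl⟩)
    (by
      rw [List.isChain_append]
      refine ⟨hch, arcL_chain G f hfa _ _, ?_⟩
      rw [hy, arcL_head _ _ _ harc]
      simp only [Option.mem_some_iff, forall_eq']
      simpa [hf] using h2.symm)
    (by
      rw [List.getLast?_append, List.head?_append, hx,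
        arcL_last _ _ _ harc]
      simp only [Option.some_or, Option.mem_some_iff, forall_eq']
      rw [show 0 + (n - t + 1) - 1 = n - t by omega, hlast]
      exact h1)
  have := hmax _ _ hd
  rw [List.length_append, arcL_length] at this
  omega

/-- The cycle `P, f k, ..., f (k + m₁ - 1), f a, ..., f (k - 1), f 0`. -/
lemma big_cycle (G : SimpleGraph V) (n : ℕ) (f : ℕ → V) (k m a : ℕ)
    (hfa : ∀ j, G.Adj (f j) (f (j + 1)))
    (hfi : ∀ i j, i < n → j < n → f i = f j → i = j)
    (P : List V) (x y : V)
    (hnd : P.Nodup) (hch : P.IsChain G.Adj) (hx : P.head? = some x) (hy : P.getLast? = some y)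
    (hoff : ∀ v ∈ P, ∀ j, f j ≠ v) (h1 : G.Adj (f 0) x) (h2 : G.Adj (f k) y)
    (hm : 1 ≤ m) (hkm : k + m ≤ n) (ha : 1 ≤ a) (hak : a < k)
    (hcross : G.Adj (f (k + m - 1)) (f a)) (he : G.Adj (f 0) (f (k - 1))) :
    ∃ d : ZMod (P.length + m + (k - a) + 1) → V,
      IsCycleOn G (P.length + m + (k - a) + 1) d ∧
      ∀ v, v ∈ Set.range d ↔ (v ∈ P ∨ (∃ j, k ≤ j ∧ j < k + m ∧ f j = v) ∨
        (∃ j, a ≤ j ∧ j < k ∧ f j = v) ∨ v = f 0) := by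
  have hP : 1 ≤ P.length := by
    cases P with
    | nil => simp at hx
    | cons => simp
  have hlen : (P ++ (arcL f k m ++ (arcL f a (k - a) ++ [f 0]))).length
      = P.length + m + (k - a) + 1 := by
    simp only [List.length_append, arcL_length, List.length_singleton]; omega
  have key := cycle_of_list G (P ++ (arcL f k m ++ (arcL f a (k - a) ++ [f 0])))
    (by rw [hlen]; omega)
    (by
      simp only [List.nodup_append', List.disjoint_append_right, List.disjoint_singleton]
      have hd : ∀ b l, List.Disjoint P (arcL f b l) := by
        intro b l v hv hv'
        obtain ⟨j, _, _, rfl⟩ := (arcL_mem _ _ _ _).1 hv'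
        exact hoff _ hv j rfl
      refine ⟨hnd, ⟨arcL_nodup f k m n hfi (by omega), ⟨arcL_nodup f a _ n hfi (by omega),
        List.nodup_singleton _, ?_⟩, ?_, ?_⟩, hd _ _, hd _ _, ?_⟩
      · intro h
        obtain ⟨j, h1, h2, h3⟩ := (arcL_mem _ _ _ _).1 h
        have := hfi _ _ (by omega) (by omega) h3
        omega
      · intro v hv hv'
        obtain ⟨j, h1, h2, h3⟩ := (arcL_mem _ _ _ _).1 hv
        obtain ⟨j', h1', h2', h3'⟩ := (arcL_mem _ _ _ _).1 hv'
        have := hfi j j' (by omega) (by omega) (h3.trans h3'.symm)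
        omega
      · intro h
        obtain ⟨j, h1, h2, h3⟩ := (arcL_mem _ _ _ _).1 h
        have := hfi _ _ (by omega) (by omega) h3
        omega
      · intro h
        exact hoff _ h 0 rfl)
    (by
      simp only [List.isChain_append, List.head?_append, arcL_head f k m hm,
        arcL_last f k m hm, arcL_head f a (k - a) (by omega), arcL_last f a (k - a) (by omega), hy,
        Option.some_or, Option.mem_some_iff, forall_eq', List.head?_cons]
      refine ⟨hch, ⟨arcL_chain G f hfa _ _, ⟨arcL_chain G f hfa _ _, List.isChain_singleton _, ?_⟩,
        hcross⟩, h2.symm⟩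
      rw [show a + (k - a) - 1 = k - 1 by omega]
      exact he.symm)
    (by
      simp only [List.getLast?_append, List.head?_append, hx, List.getLast?_singleton,
        Option.some_or, Option.mem_some_iff, forall_eq']
      exact h1)
  rw [hlen] at key
  obtain ⟨d, hd, hr⟩ := key
  refine ⟨d, hd, fun v => ?_⟩
  rw [hr]
  simp only [List.mem_append, arcL_mem, List.mem_singleton]
  rw [show a + (k - a) = k by omega]

/-- The exchange argument for components. -/
lemma exchange (G : SimpleGraph V) (R R' H : Set V) (hH : IsCompOff G R H)
    (hHmu : H.ncard = muC G R) (hH2 : 2 ≤ H.ncard) (a b x : V)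
    (haN : ∀ v, G.Adj a v → v ∈ R) (hbN : ∀ v, G.Adj b v → v ∈ R) (hab : ¬ G.Adj a b)
    (hsub : ∀ v ∈ R, v ≠ a → v ≠ b → v ∈ R') (hsub' : ∀ v ∈ R', v ∈ R ∨ v ∈ H)
    (hxH : x ∈ H) (hxR : x ∈ R')
    (hmin : muC G R ≤ muC G R' ∧ (muC G R = muC G R' → omegaC G R ≤ omegaC G R')) : False := by
  have hbdd : ∀ R : Set V, BddAbove {k | ∃ H : Set V, IsCompOff G R H ∧ H.ncard = k} := by
    intro R
    refine ⟨Nat.card V, ?_⟩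
    rintro k ⟨K, _, rfl⟩
    exact (Set.ncard_le_card K)
  have hcl : ∀ K, IsCompOff G R' K → K.ncard = 1 ∨ K ⊂ H ∨ (IsCompOff G R K ∧ K ≠ H) := by
    intro K hK
    obtain ⟨hKne, hKd, hKc, hKcl⟩ := hK
    have hsing : ∀ a b : V, (∀ v, G.Adj a v → v ∈ R) → ¬ G.Adj a b →
        (∀ v ∈ R, v ≠ a → v ≠ b → v ∈ R') → a ∈ K → K.ncard = 1 := by
      intro a b haN hab hsub haK
      have : K ⊆ {a} := by
        apply conn_closed G K {a} hKc a haK rfl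
        intro u v hu hv hua huv
        obtain rfl : u = a := hua
        by_contra hva
        have hvb : v ≠ b := by rintro rfl; exact hab huv
        exact Set.disjoint_left.1 hKd hv (hsub v (haN v huv) hva hvb)
      have : K = {a} := Set.Subset.antisymm this (by simpa using haK)
      simp [this]
    by_cases haK : a ∈ K
    · exact Or.inl (hsing a b haN hab hsub haK)
    by_cases hbK : b ∈ K
    · exact Or.inl (hsing b a hbN (fun h => hab h.symm) (fun v h1 h2 h3 => hsub v h1 h3 h2) hbK)
    right
    have hKR : ∀ v ∈ K, v ∉ R := by
      intro v hv hvR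
      exact Set.disjoint_left.1 hKd hv
        (hsub v hvR (by rintro rfl; exact haK hv) (by rintro rfl; exact hbK hv))
    have hxK : x ∉ K := fun h => Set.disjoint_left.1 hKd h hxR
    by_cases hmeet : ∃ u ∈ K, u ∈ H
    · obtain ⟨u, hu, huH⟩ := hmeet
      left
      have : K ⊆ H := by
        apply conn_closed G K H hKc u hu huH
        intro p q hp hq hpH hpq
        by_contra hqH
        exact hH.2.2.2 p q hpH hqH (hKR q hq) hpq
      exact ⟨this, fun h => hxK (h hxH)⟩
    · right
      push Not at hmeet
      refine ⟨⟨hKne, Set.disjoint_left.2 hKR, hKc, ?_⟩, fun h => hxK (h ▸ hxH)⟩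
      intro u v hu hv hvR huv
      by_cases hvR' : v ∈ R'
      · rcases hsub' v hvR' with h | h
        · exact hvR h
        · exact hH.2.2.2 v u h (hmeet u hu) (hKR u hu) huv.symm
      · exact hKcl u v hu hv hvR' huv
  have hle : muC G R' ≤ muC G R := by
    rcases Set.eq_empty_or_nonempty {k | ∃ H : Set V, IsCompOff G R' H ∧ H.ncard = k} with h | h
    · unfold muC; rw [h]; simp
    · apply csSup_le h
      rintro k ⟨K, hK, rfl⟩
      rcases hcl K hK with h | h | h
      · omega
      · rw [← hHmu]; exact Set.ncard_le_ncard h.1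
      · exact le_csSup (hbdd R) ⟨K, h.1, rfl⟩
  have heq : muC G R = muC G R' := le_antisymm hmin.1 hle
  have hom := hmin.2 heq
  have : omegaC G R' < omegaC G R := by
    unfold omegaC
    apply Set.ncard_lt_ncard _ (Set.toFinite _)
    refine ⟨?_, ?_⟩
    · rintro K ⟨hK, hKc⟩
      rcases hcl K hK with h | h | h
      · omega
      · have := Set.ncard_lt_ncard h (Set.toFinite _)
        omega
      · exact ⟨h.1, by rw [heq]; exact hKc⟩
    · intro h
      have hh : H ∈ {H : Set V | IsCompOff G R' H ∧ H.ncard = muC G R'} := h ⟨hH, hHmu⟩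
      exact Set.disjoint_left.1 hh.1.2.1 hxH hxR
  omega

/-- A neighbour on the cycle of `v` has no neighbour off the cycle. -/
lemma nbr_on (G : SimpleGraph V) (hG : P5Free G) (R H : Set V) (hH : IsCompOff G R H)
    (v w : V) (hvR : v ∈ R) (hwR : w ∈ R) (hvw : G.Adj v w)
    (h1 : ∃ x ∈ H, G.Adj v x) (hnon : ∃ x ∈ H, ¬ G.Adj v x)
    (hno : ∀ (P : List V) (x y : V), P.Nodup → P.IsChain G.Adj → P.head? = some x →
      P.getLast? = some y → (∀ u ∈ P, u ∉ R) → G.Adj v x → ¬ G.Adj w y) :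
    ∀ d, G.Adj w d → d ∈ R := by
  intro d hwd
  by_contra hdR
  have hHR : ∀ u ∈ H, u ∉ R := fun u hu => Set.disjoint_left.1 hH.2.1 hu
  have hwH : ∀ z ∈ H, ¬ G.Adj w z := by
    intro z hz
    obtain ⟨x, hx, hvx⟩ := h1
    obtain ⟨P, p1, p2, p3, p4, p5⟩ := exists_list_path G H hH.2.2.1 x z hx hz
    exact hno P x z p1 p2 p3 p4 (fun u hu => hHR u (p5 u hu)) hvx
  have hdH : d ∉ H := fun h => hwH d h hwd
  have hvd : ¬ G.Adj v d := fun h =>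
    hno [d] d d (by simp) (by simp) rfl rfl (by simpa using hdR) h hwd
  obtain ⟨x, hx, y, hy, hxy, hvx, hvy⟩ :
      ∃ x ∈ H, ∃ y ∈ H, G.Adj x y ∧ G.Adj v x ∧ ¬ G.Adj v y := by
    by_contra hcon
    push Not at hcon
    obtain ⟨x, hx, hvx⟩ := h1
    obtain ⟨y, hy, hvy⟩ := hnon
    exact hvy (conn_closed G H {z | G.Adj v z} hH.2.2.1 x hx hvx
      (fun p q hp hq hvp hpq => hcon p hp q hq hpq hvp) hy)
  have hxd : ¬ G.Adj x d := hH.2.2.2 x d hx hdH hdR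
  have hyd : ¬ G.Adj y d := hH.2.2.2 y d hy hdH hdR
  have hxw : ¬ G.Adj x w := fun h => hwH x hx h.symm
  have hyw : ¬ G.Adj y w := fun h => hwH y hy h.symm
  have hyv : ¬ G.Adj y v := fun h => hvy h.symm
  have hxR := hHR x hx
  have hyR := hHR y hy
  have e1 : y ≠ x := hxy.ne'
  have e2 : y ≠ v := by rintro rfl; exact hyR hvR
  have e3 : y ≠ w := by rintro rfl; exact hyR hwR
  have e4 : y ≠ d := by rintro rfl; exact hdH hy
  have e5 : x ≠ v := by rintro rfl; exact hxR hvR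
  have e6 : x ≠ w := by rintro rfl; exact hxR hwR
  have e7 : x ≠ d := by rintro rfl; exact hdH hx
  have e8 : v ≠ w := hvw.ne
  have e9 : v ≠ d := by rintro rfl; exact hdR hvR
  have e10 : w ≠ d := hwd.ne
  apply hG
  refine ⟨fun k => match k with | 0 => y | 1 => x | 2 => v | 3 => w | _ => d, ⟨?_, ?_⟩, ?_⟩
  · intro i j hi hj
    interval_cases i <;> interval_cases j <;> simp_all [eq_comm]
  · intro i hi
    have : i < 4 := by omega
    interval_cases i
    · exact hxy.symm
    · exact hvx.symm
    · exact hvw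
    · exact hwd
  · intro i j hi hj
    interval_cases i <;> interval_cases j <;> simp_all [G.adj_comm]

theorem stmt_15 (G : SimpleGraph V) (hG : P5Free G)
    (hnd : ∀ (m : ℕ) (d : ZMod m → V), IsLongestCycle G m d → ¬ DominatingCycle G m d)
    (n : ℕ) (c : ZMod n → V) (hc : IsLongestCycle G n c)
    (hmin : ∀ (m : ℕ) (d : ZMod m → V), IsLongestCycle G m d →
      muC G (Set.range c) ≤ muC G (Set.range d) ∧
      (muC G (Set.range c) = muC G (Set.range d) →
        omegaC G (Set.range c) ≤ omegaC G (Set.range d)))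
    (H : Set V) (hH : IsCompOff G (Set.range c) H)
    (hHmu : H.ncard = muC G (Set.range c)) (hH2 : 2 ≤ H.ncard)
    (i1 i2 : ZMod n) (hne : c i1 ≠ c i2)
    (h1 : ∃ x ∈ H, G.Adj (c i1) x) (h2 : ∃ x ∈ H, G.Adj (c i2) x)
    (hcard : 2 ≤ ({x | x ∈ H ∧ G.Adj (c i1) x} ∪ {x | x ∈ H ∧ G.Adj (c i2) x}).ncard)
    (hnon : ∃ x ∈ H, ¬ G.Adj (c i1) x)
    (he : G.Adj (c i1) (c (i2 - 1))) :
    ¬ G.Adj (c (i1 - 2)) (c (i1 + 2)) := by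
  intro hadj2
  have hc0 := hc
  obtain ⟨⟨h3, hinj, hadj⟩, hmax⟩ := hc0
  haveI : NeZero n := ⟨by omega⟩
  have hHR : ∀ u ∈ H, u ∉ Set.range c := fun u hu => Set.disjoint_left.1 hH.2.1 hu
  -- distinct representatives
  obtain ⟨x, y, hxy, hx, hy, h1x, h2y⟩ :
      ∃ x y, x ≠ y ∧ x ∈ H ∧ y ∈ H ∧ G.Adj (c i1) x ∧ G.Adj (c i2) y := by
    obtain ⟨x, hx, h1x⟩ := h1
    obtain ⟨y, hy, h2y⟩ := h2
    by_cases hxy : x = y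
    · subst hxy
      obtain ⟨z, hz, hzx⟩ := Set.exists_ne_of_one_lt_ncard hcard x
      rcases hz with ⟨hz, hz'⟩ | ⟨hz, hz'⟩
      · exact ⟨z, x, hzx, hz, hy, hz', h2y⟩
      · exact ⟨x, z, hzx.symm, hx, hz, h1x, hz'⟩
    · exact ⟨x, y, hxy, hx, hy, h1x, h2y⟩
  obtain ⟨P, p1, p2, p3, p4, p5⟩ := exists_list_path G H hH.2.2.1 x y hx hy
  have hPR : ∀ u ∈ P, u ∉ Set.range c := fun u hu => hHR u (p5 u hu)
  have hPlen : 2 ≤ P.length := by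
    match P, p3, p4 with
    | [], h, _ => simp at h
    | [z], h, h' => simp at h h'; exact absurd (h.symm.trans h') hxy
    | _ :: _ :: _, _, _ => simp
  have hxP : x ∈ P := List.mem_of_mem_head? p3
  -- no neighbours of the two cyclic neighbours off the cycle
  have hplus : ∀ d, G.Adj (c (i1 + 1)) d → d ∈ Set.range c := by
    refine nbr_on G hG _ H hH (c i1) _ ⟨_, rfl⟩ ⟨_, rfl⟩ (hadj i1) h1 hnon ?_
    intro Q a b q1 q2 q3 q4 q5 ha hb
    have := no_detour G n c hc i1 1 le_rfl (by omega) Q a b q1 q2 q3 q4 q5 ha (by simpa using hb)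
    have : Q = [] := List.length_eq_zero_iff.1 (by omega)
    simp [this] at q3
  have hminus : ∀ d, G.Adj (c (i1 - 1)) d → d ∈ Set.range c := by
    have hadj' : G.Adj (c i1) (c (i1 - 1)) := by
      have := (hadj (i1 - 1)).symm
      simpa using this
    refine nbr_on G hG _ H hH (c i1) _ ⟨_, rfl⟩ ⟨_, rfl⟩ hadj' h1 hnon ?_
    intro Q a b q1 q2 q3 q4 q5 ha hb
    have := no_detour G n c hc (i1 - 1) 1 le_rfl (by omega) Q.reverse b a
      (List.nodup_reverse.2 q1)
      (by rw [List.isChain_reverse]; exact q2.imp (fun _ _ h => h.symm))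
      (by rw [List.head?_reverse]; exact q4) (by rw [List.getLast?_reverse]; exact q3)
      (by simpa using q5) hb (by simpa using ha)
    have : Q = [] := List.length_eq_zero_iff.1 (by rw [List.length_reverse] at this; omega)
    simp [this] at q3
  -- coordinates
  obtain ⟨k, hk⟩ : ∃ k, k = (i2 - i1).val := ⟨_, rfl⟩
  have hkn : k < n := hk ▸ ZMod.val_lt _
  have hi2 : i2 = i1 + (k : ZMod n) := by rw [hk, ZMod.natCast_zmod_val]; ring
  have hk0 : 1 ≤ k := by
    rcases Nat.eq_zero_or_pos k with h | h
    · subst h; simp at hi2; exact absurd (by rw [hi2]) hne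
    · exact h
  have hk3 := no_detour G n c hc i1 k hk0 hkn P x y p1 p2 p3 p4 hPR h1x (hi2 ▸ h2y)
  have hk3' := no_detour G n c hc i2 (n - k) (by omega) (by omega) P.reverse y x
      (List.nodup_reverse.2 p1)
      (by rw [List.isChain_reverse]; exact p2.imp (fun _ _ h => h.symm))
      (by rw [List.head?_reverse]; exact p4) (by rw [List.getLast?_reverse]; exact p3)
      (by simpa using hPR) h2y
      (by
        rw [hi2, Nat.cast_sub hkn.le]
        simpa using h1x)
  rw [List.length_reverse] at hk3'
  obtain ⟨f, hf⟩ : ∃ f : ℕ → V, ∀ j : ℕ, f j = c (i1 + j) := ⟨_, fun _ => rfl⟩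
  have hfa : ∀ j, G.Adj (f j) (f (j + 1)) := by
    intro j
    have := hadj (i1 + j)
    rw [hf, hf]
    simpa [add_assoc] using this
  have hfi : ∀ a b, a < n → b < n → f a = f b → a = b := by
    intro a b ha hb hab
    rw [hf, hf] at hab
    have h := (ZMod.natCast_eq_natCast_iff' a b n).1 (add_left_cancel (hinj hab))
    rwa [Nat.mod_eq_of_lt ha, Nat.mod_eq_of_lt hb] at h
  have hfR : ∀ v ∈ Set.range c, ∃ j, j < n ∧ f j = v := by
    rintro v ⟨i, rfl⟩
    refine ⟨(i - i1).val, ZMod.val_lt _, ?_⟩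
    rw [hf, ZMod.natCast_zmod_val]; congr 1; ring
  have hfR' : ∀ j, f j ∈ Set.range c := fun j => by rw [hf]; exact ⟨_, rfl⟩
  have hPf : ∀ v ∈ P, ∀ j, f j ≠ v := fun v hv j h => hPR v hv (h ▸ hfR' j)
  have f0 : f 0 = c i1 := by simp [hf]
  have f1 : f 1 = c (i1 + 1) := by simp [hf]
  have f2 : f 2 = c (i1 + 2) := by simp [hf]
  have fk : f k = c i2 := by rw [hf, hi2]
  have fk1 : f (k - 1) = c (i2 - 1) := by
    rw [hf, hi2, Nat.cast_sub hk0]; congr 1; push_cast; ring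
  have fn1 : f (n - 1) = c (i1 - 1) := by
    rw [hf, Nat.cast_sub (by omega)]; congr 1; simp; ring
  have fn2 : f (n - 2) = c (i1 - 2) := by
    rw [hf, Nat.cast_sub (by omega)]; congr 1; simp; ring
  rw [← f0] at h1x he
  rw [← fk] at h2y
  rw [← fk1] at he
  rw [← f1] at hplus
  rw [← fn1] at hminus
  rw [← f2, ← fn2] at hadj2
  have hab : ¬ G.Adj (f 1) (f (n - 1)) := by
    intro h
    obtain ⟨d, hd, _⟩ := big_cycle G n f k (n - k) 1 hfa hfi P x y p1 p2 p3 p4 hPf h1x h2y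
      (by omega) (by omega) le_rfl (by omega)
      (by rw [show k + (n - k) - 1 = n - 1 by omega]; exact h.symm) he
    have := hmax _ _ hd
    omega
  obtain ⟨d, hd, hdr⟩ := big_cycle G n f k (n - 1 - k) 2 hfa hfi P x y p1 p2 p3 p4 hPf h1x h2y
      (by omega) (by omega) (by omega) (by omega)
      (by rw [show k + (n - 1 - k) - 1 = n - 2 by omega]; exact hadj2) he
  have hdl := hmax _ _ hd
  have hdlong : IsLongestCycle G _ d := ⟨hd, fun m e he => (hmax m e he).trans (by omega)⟩
  refine exchange G (Set.range c) (Set.range d) H hH hHmu hH2 (f 1) (f (n - 1)) x hplus hminus hab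
    ?_ ?_ hx ((hdr x).2 (Or.inl hxP)) (hmin _ d hdlong)
  · intro v hv hva hvb
    obtain ⟨j, hj, rfl⟩ := hfR v hv
    rw [hdr]
    have hj1 : j ≠ 1 := by rintro rfl; exact hva rfl
    have hj2 : j ≠ n - 1 := by rintro rfl; exact hvb rfl
    right
    rcases Nat.eq_zero_or_pos j with h | h
    · subst h; exact Or.inr (Or.inr rfl)
    by_cases hjk : k ≤ j
    · exact Or.inl ⟨j, hjk, by omega, rfl⟩
    · exact Or.inr (Or.inl ⟨j, by omega, by omega, rfl⟩)
  · intro v hv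
    rcases (hdr v).1 hv with h | ⟨j, _, _, rfl⟩ | ⟨j, _, _, rfl⟩ | rfl
    · exact Or.inr (p5 v h)
    · exact Or.inl (hfR' _)
    · exact Or.inl (hfR' _)
    · exact Or.inl (hfR' _)
end
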